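/- Let S ⊆ ℝ² be a nice shape, let X ⊆ ℝ² be a finite point set in general position with respect to S, and let k be an integer with 3 ≤ k ≤ |X|. Let ℛ₁ᵏ denote the set of all S-ranges S' such that |X ∩ S'| = k and exactly three points of X lie on the boundary ∂S'. Then |ℛ₁ᵏ| = 2(k−2)·|X| − Σ_{i=2}^{k−1} |𝒜_i| − (k−1)(k−2). -/

import Mathlib

open Set

noncomputable section

/-- The Euclidean plane. -/
abbrev Pt : Type := EuclideanSpace ℝ (Fin 2)

/-- `T` is an `S`-range: a homothetic copy of `S` with positive ratio. -/
def IsRange (S T : Set Pt) : Prop :=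
  ∃ (c : ℝ) (v : Pt), 0 < c ∧ T = (fun x => c • x + v) '' S

/-- A straight line in the plane. -/
def IsLine (l : Set Pt) : Prop :=
  ∃ (f : Pt →ₗ[ℝ] ℝ) (a : ℝ), f ≠ 0 ∧ l = {x | f x = a}

/-- A closed halfplane. -/
def IsClosedHalfplane (H : Set Pt) : Prop :=
  ∃ (f : Pt →ₗ[ℝ] ℝ) (a : ℝ), f ≠ 0 ∧ H = {x | f x ≤ a}

/-- An open halfplane bounded by the line through `p` and `q`. -/
def IsOpenHalfplaneOf (p q : Pt) (L : Set Pt) : Prop :=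
  ∃ (f : Pt →ₗ[ℝ] ℝ) (a : ℝ), f ≠ 0 ∧ f p = a ∧ f q = a ∧ L = {x | a < f x}

/-- `S` is a nice shape: a non-empty convex compact set such that every boundary
point has exactly one touching line and the boundary contains no non-trivial
straight line segment. -/
def NiceShape (S : Set Pt) : Prop :=
  S.Nonempty ∧ Convex ℝ S ∧ IsCompact S ∧
  (∀ p ∈ frontier S, ∃! l : Set Pt, IsLine l ∧ l ∩ S = {p}) ∧
  (∀ x ∈ frontier S, ∀ y ∈ frontier S, segment ℝ x y ⊆ frontier S → x = y)

/-- No four points of `A` lie on the boundary of a common `S`-range. -/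
def NoFourOnBoundary (S A : Set Pt) : Prop :=
  ∀ T : Set Pt, IsRange S T →
    ∀ p₁ p₂ p₃ p₄ : Pt, p₁ ∈ A ∩ frontier T → p₂ ∈ A ∩ frontier T →
      p₃ ∈ A ∩ frontier T → p₄ ∈ A ∩ frontier T →
      p₁ ≠ p₂ → p₁ ≠ p₃ → p₁ ≠ p₄ → p₂ ≠ p₃ → p₂ ≠ p₄ → p₃ ≠ p₄ → False

/-- `X` is in general position with respect to `S`: no two points on a vertical
line, no three points collinear, and no four points on the boundary of a common
`S`-range. -/
def GenPos (S : Set Pt) (X : Finset Pt) : Prop :=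
  (∀ p ∈ X, ∀ q ∈ X, p ≠ q → p 0 ≠ q 0) ∧
  (∀ p ∈ X, ∀ q ∈ X, ∀ r ∈ X, p ≠ q → p ≠ r → q ≠ r →
    ¬ Collinear ℝ ({p, q, r} : Set Pt)) ∧
  NoFourOnBoundary S ↑X

/-- The hyperedges of the `k`-uniform `S`-capturing hypergraph on `X`:
`k`-element subsets of `X` captured by some `S`-range. -/
def capturedSets (S : Set Pt) (X : Finset Pt) (k : ℕ) : Set (Set Pt) :=
  {Y | Y ⊆ ↑X ∧ Y.ncard = k ∧ ∃ T : Set Pt, IsRange S T ∧ ↑X ∩ T = Y}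

/-- The `i`-sets of `X`: `i`-element subsets of `X` separable by a straight line,
i.e. captured by a closed halfplane.  `aᵢ` is the number of such sets. -/
def iSets (X : Finset Pt) (i : ℕ) : Set (Set Pt) :=
  {Y | Y ⊆ ↑X ∧ Y.ncard = i ∧ ∃ H : Set Pt, IsClosedHalfplane H ∧ ↑X ∩ H = Y}

/-- `𝒜ᵢ`: closed halfplanes containing exactly `i` points of `X`, exactly two of
which lie on the boundary line. -/
def repHalfplanes (X : Finset Pt) (i : ℕ) : Set (Set Pt) :=
  {H | IsClosedHalfplane H ∧ ((↑X : Set Pt) ∩ H).ncard = i ∧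
    ((↑X : Set Pt) ∩ frontier H).ncard = 2}

/-- `𝒮_pq`: the `S`-ranges having both `p` and `q` on their boundary. -/
def rangesThrough (S : Set Pt) (p q : Pt) : Set (Set Pt) :=
  {T | IsRange S T ∧ p ∈ frontier T ∧ q ∈ frontier T}

/-- The ranges in `𝒮_pq` that come strictly after `S₁` (w.r.t. `≺`, i.e. inclusion
of the intersections with `L`) and have a point of `X` on their boundary that is
not on the boundary of `S₁`. -/
def nextCandidates (S : Set Pt) (p q : Pt) (L : Set Pt) (X : Finset Pt) (S₁ : Set Pt) :
    Set (Set Pt) :=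
  {S₂ | S₂ ∈ rangesThrough S p q ∧ S₁ ∩ L ⊂ S₂ ∩ L ∧
    ((frontier S₂ \ frontier S₁) ∩ ↑X).Nonempty}

/-- `ℛ₁ᵏ`: Type I ranges, i.e. `S`-ranges containing exactly `k` points of `X`,
exactly three of which are on the boundary. -/
def typeIRanges (S : Set Pt) (X : Finset Pt) (k : ℕ) : Set (Set Pt) :=
  {T | IsRange S T ∧ ((↑X : Set Pt) ∩ T).ncard = k ∧
    ((↑X : Set Pt) ∩ frontier T).ncard = 3}

/-- `ℛ(Y)`: the Type I representative ranges of `Y`. -/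
def repRanges (S : Set Pt) (X : Finset Pt) (Y : Set Pt) : Set (Set Pt) :=
  {T | IsRange S T ∧ ↑X ∩ T = Y ∧ ((↑X : Set Pt) ∩ frontier T).ncard = 3}

/-- `ℰ₁ᵏ`: Type I hyperedges. -/
def typeIEdges (S : Set Pt) (X : Finset Pt) (k : ℕ) : Set (Set Pt) :=
  {Y | Y ⊆ ↑X ∧ Y.ncard = k ∧ (repRanges S X Y).Nonempty}

/-- `ℰ₂ᵏ`: Type II hyperedges, captured by some `S`-range but by no `S`-range with
three points of `X` on its boundary. -/
def typeIIEdges (S : Set Pt) (X : Finset Pt) (k : ℕ) : Set (Set Pt) :=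
  {Y | Y ∈ capturedSets S X k ∧ ¬ (repRanges S X Y).Nonempty}

/-- Twice the signed area of the triangle `a b c`. -/
def det (a b c : Pt) : ℝ :=
  (b 0 - a 0) * (c 1 - a 1) - (b 1 - a 1) * (c 0 - a 0)

theorem det_swap (a b c : Pt) : det b a c = - det a b c := by
  simp only [det]; ring

theorem det_rotate (a b c : Pt) : det b c a = det a b c := by
  simp only [det]; ring

theorem det_self_left (a b : Pt) : det a b a = 0 := by
  simp only [det]; ring

theorem det_self_right (a b : Pt) : det a b b = 0 := by
  simp only [det]; ring

/-- Cramer's rule for a point in the plane of a triangle. -/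
theorem det_smul_combo (a b c z : Pt) :
    det a b c • z = det z b c • a + det a z c • b + det a b z • c := by
  ext i
  fin_cases i <;> simp [det] <;> ring

theorem det_add_det_add_det (a b c z : Pt) :
    det z b c + det a z c + det a b z = det a b c := by
  simp only [det]; ring

theorem eq_of_coords {a b : Pt} (h₀ : a 0 = b 0) (h₁ : a 1 = b 1) : a = b := by
  ext i
  fin_cases i
  · exact h₀
  · exact h₁

theorem ne_of_det_ne {a b c : Pt} (h : det a b c ≠ 0) : a ≠ b ∧ a ≠ c ∧ b ≠ c := by
  refine ⟨?_, ?_, ?_⟩ <;> rintro rfl <;> apply h <;> simp only [det] <;> ring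

/-- In a strictly convex set, a convex combination of three points that gives positive weight to
two distinct ones is interior. -/
theorem StrictConvex.combo_three_mem_interior {T : Set Pt} (hT : StrictConvex ℝ T) {a b c : Pt}
    (ha : a ∈ T) (hb : b ∈ T) (hc : c ∈ T) (hab : a ≠ b) {α β γ : ℝ} (hα : 0 < α) (hβ : 0 < β)
    (hγ : 0 ≤ γ) (hsum : α + β + γ = 1) : α • a + β • b + γ • c ∈ interior T := by
  have hs : 0 < α + β := by positivity
  have hm : (α / (α + β)) • a + (β / (α + β)) • b ∈ interior T :=
    hT ha hb hab (by positivity) (by positivity) (by field_simp)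
  have := hT.convex.combo_interior_self_mem_interior hm hc hs hγ hsum
  convert this using 2
  rw [smul_add, smul_smul, smul_smul]
  congr 2 <;> field_simp

/-- Homogeneous form of `StrictConvex.combo_three_mem_interior`, for barycentric coordinates given
by determinants. -/
theorem StrictConvex.mem_interior_of_det {T : Set Pt} (hT : StrictConvex ℝ T) {a b c z : Pt}
    (ha : a ∈ T) (hb : b ∈ T) (hc : c ∈ T) (h₁ : 0 < det z b c) (h₂ : 0 ≤ det a z c)
    (h₃ : 0 < det a b z) : z ∈ interior T := by
  have hsum := det_add_det_add_det a b c z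
  have hpos : 0 < det a b c := by linarith
  have hne : a ≠ c := (ne_of_det_ne hpos.ne').2.1
  have key := hT.combo_three_mem_interior ha hc hb hne (div_pos h₁ hpos) (div_pos h₃ hpos)
    (div_nonneg h₂ hpos.le) (by field_simp; linarith)
  have hz : z = (det a b c)⁻¹ • (det a b c • z) := by
    rw [smul_smul, inv_mul_cancel₀ hpos.ne', one_smul]
  have hz' : z = (det z b c / det a b c) • a + (det a b z / det a b c) • c +
      (det a z c / det a b c) • b := by
    refine hz.trans ?_
    rw [det_smul_combo a b c z]
    simp only [smul_add, smul_smul, div_eq_inv_mul]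
    abel
  rw [hz']
  exact key

/-- A homothety with ratio `μ`. -/
def hom (μ : ℝ) (w : Pt) (z : Pt) : Pt := μ • z + w

theorem hom_apply (μ : ℝ) (w z : Pt) (i : Fin 2) : hom μ w z i = μ * z i + w i := by
  simp [hom]

/-- If two homothets of a strictly convex set share two boundary points, the one whose chord has
been moved down is the smaller one above the chord. -/
theorem mem_interior_of_hom_mem {T : Set Pt} (hT : StrictConvex ℝ T) {μ : ℝ} (hμ : 0 < μ)
    {w p q r : Pt} (hp : p ∈ T) (hq : q ∈ T) (hp' : hom μ w p ∈ T) (hq' : hom μ w q ∈ T)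
    (hpi : hom μ w p ∉ interior T) (hqi : hom μ w q ∉ interior T)
    (hh : 0 < det p q (hom μ w p)) (hr' : hom μ w r ∈ T) (hr : 0 < det p q r) :
    r ∈ interior T := by
  set p' := hom μ w p with hp'_def
  set q' := hom μ w q with hq'_def
  set r' := hom μ w r with hr'_def
  have e₁ : det p' q' r' = μ ^ 2 * det p q r := by
    simp only [det, p', q', r', hom_apply]; ring
  have e₂ : det p q' p' = μ * det p q p' := by
    simp only [det, p', q', hom_apply]; ring
  have e₃ : det p' q q' = μ * det p q p' := by
    simp only [det, p', q', hom_apply]; ring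
  have pos : 0 < μ * det p q p' := by positivity
  have pos' : 0 < μ ^ 2 * det p q r := by positivity
  have c₁ : det p p' r' < 0 := by
    by_contra! h
    refine hpi (hT.mem_interior_of_det hp hq' hr' ?_ h ?_)
    · rw [e₁]; exact pos'
    · rw [e₂]; exact pos
  have c₂ : 0 < det q q' r' := by
    by_contra! h
    refine hqi (hT.mem_interior_of_det hr' hp' hq (c := q) ?_ ?_ ?_)
    · rw [← det_rotate, e₃]; exact pos
    · have : det r' q' q = - det q q' r' := by simp only [det]; ring
      rw [this]; linarith
    · rw [← det_rotate, e₁]; exact pos'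
  have f₁ : det p p' r' = -μ * det p r r' := by
    simp only [det, p', r', hom_apply]; ring
  have f₂ : det q q' r' = μ * det r q r' := by
    simp only [det, q', r', hom_apply]; ring
  refine hT.mem_interior_of_det hp hq hr' ?_ ?_ hr
  · rw [f₂] at c₂
    exact pos_of_mul_pos_right c₂ hμ.le
  · by_contra! h
    rw [f₁] at c₁
    nlinarith [mul_pos hμ (neg_pos.2 h)]

theorem hom_hom_inv {μ : ℝ} (hμ : μ ≠ 0) (w z : Pt) : hom μ w (hom μ⁻¹ (-(μ⁻¹ • w)) z) = z := by
  ext i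
  simp only [hom_apply, PiLp.neg_apply, PiLp.smul_apply, smul_eq_mul]
  field_simp
  ring

theorem hom_inv_hom {μ : ℝ} (hμ : μ ≠ 0) (w z : Pt) : hom μ⁻¹ (-(μ⁻¹ • w)) (hom μ w z) = z := by
  ext i
  simp only [hom_apply, PiLp.neg_apply, PiLp.smul_apply, smul_eq_mul]
  field_simp
  ring

/-- A homothety as a homeomorphism. -/
def homHomeomorph (μ : ℝ) (hμ : μ ≠ 0) (w : Pt) : Pt ≃ₜ Pt where
  toFun := hom μ w
  invFun := hom μ⁻¹ (-(μ⁻¹ • w))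
  left_inv z := hom_inv_hom hμ w z
  right_inv z := hom_hom_inv hμ w z
  continuous_toFun := by unfold hom; fun_prop
  continuous_invFun := by unfold hom; fun_prop

theorem mem_interior_preimage_hom {μ : ℝ} (hμ : μ ≠ 0) (w z : Pt) (T : Set Pt) :
    z ∈ interior (hom μ w ⁻¹' T) ↔ hom μ w z ∈ interior T := by
  have := (homHomeomorph μ hμ w).preimage_interior T
  have h2 : (homHomeomorph μ hμ w : Pt → Pt) = hom μ w := rfl
  rw [h2] at this
  rw [← this]
  rfl

theorem mem_frontier_preimage_hom {μ : ℝ} (hμ : μ ≠ 0) (w z : Pt) (T : Set Pt) :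
    z ∈ frontier (hom μ w ⁻¹' T) ↔ hom μ w z ∈ frontier T := by
  have := (homHomeomorph μ hμ w).preimage_frontier T
  have h2 : (homHomeomorph μ hμ w : Pt → Pt) = hom μ w := rfl
  rw [h2] at this
  rw [← this]
  rfl

theorem isRange_iff_preimage {S T : Set Pt} :
    IsRange S T ↔ ∃ (μ : ℝ) (w : Pt), 0 < μ ∧ T = hom μ w ⁻¹' S := by
  constructor
  · rintro ⟨c, v, hc, rfl⟩
    refine ⟨c⁻¹, -(c⁻¹ • v), inv_pos.2 hc, ?_⟩
    exact congrFun (Set.image_eq_preimage_of_inverse (fun z => hom_inv_hom hc.ne' v z)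
      (fun z => hom_hom_inv hc.ne' v z)) S
  · rintro ⟨μ, w, hμ, rfl⟩
    refine ⟨μ⁻¹, -(μ⁻¹ • w), inv_pos.2 hμ, ?_⟩
    exact congrFun (Set.image_eq_preimage_of_inverse (fun z => hom_hom_inv hμ.ne' w z)
      (fun z => hom_inv_hom hμ.ne' w z)).symm S

theorem exists_preimage_of_isRange {S T₁ T₂ : Set Pt} (h₁ : IsRange S T₁) (h₂ : IsRange S T₂) :
    ∃ (μ : ℝ) (w : Pt), 0 < μ ∧ T₂ = hom μ w ⁻¹' T₁ := by
  obtain ⟨c, v, hc, rfl⟩ := h₁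
  obtain ⟨μ, w, hμ, rfl⟩ := isRange_iff_preimage.1 h₂
  refine ⟨c * μ, c • w + v, mul_pos hc hμ, ?_⟩
  rw [Set.image_eq_preimage_of_inverse (f := fun x => c • x + v) (fun z => hom_inv_hom hc.ne' v z)
      (fun z => hom_hom_inv hc.ne' v z), ← Set.preimage_comp]
  congr 1
  funext z
  ext i
  simp only [Function.comp, hom_apply, PiLp.neg_apply, PiLp.smul_apply, PiLp.add_apply, smul_eq_mul]
  field_simp
  ring

theorem IsRange.isCompact {S T : Set Pt} (h : IsRange S T) (hS : IsCompact S) : IsCompact T := by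
  obtain ⟨c, v, -, rfl⟩ := h
  exact hS.image (by fun_prop)

theorem IsRange.strictConvex {S T : Set Pt} (h : IsRange S T) (hS : StrictConvex ℝ S) :
    StrictConvex ℝ T := by
  obtain ⟨μ, w, hμ, rfl⟩ := isRange_iff_preimage.1 h
  intro x hx y hy hxy a b ha hb hab
  rw [mem_interior_preimage_hom hμ.ne']
  have hne : hom μ w x ≠ hom μ w y := fun e => hxy <| by
    rw [← hom_inv_hom hμ.ne' w x, e, hom_inv_hom hμ.ne']
  convert hS hx hy hne ha hb hab using 1
  ext i
  simp only [hom_apply, PiLp.smul_apply, PiLp.add_apply, smul_eq_mul]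
  linear_combination (-w i) * hab

/-- On a line, a strictly convex set has at most two boundary points: two boundary points `p`, `q`
and their homothetic images cannot be collinear unless the homothety is the identity. -/
theorem hom_eq_self_of_collinear {T : Set Pt} (hT : StrictConvex ℝ T) {μ : ℝ} (hμ : 0 < μ)
    {w p q : Pt} (hpq : p ≠ q) (hp : p ∈ T) (hq : q ∈ T) (hp' : hom μ w p ∈ T)
    (hq' : hom μ w q ∈ T) (hpn : p ∉ interior T) (hqn : q ∉ interior T)
    (hpi : hom μ w p ∉ interior T) (hqi : hom μ w q ∉ interior T)
    (hh : det p q (hom μ w p) = 0) : ∀ z, hom μ w z = z := by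
  -- parametrize the line through `p` and `q`
  obtain ⟨t, ht⟩ : ∃ t : ℝ, hom μ w p = p + t • (q - p) := by
    simp only [det] at hh
    by_cases h0 : q 0 - p 0 = 0
    · have h1 : q 1 - p 1 ≠ 0 := fun h1 =>
        hpq (eq_of_coords (by linarith) (by linarith))
      rw [h0] at hh
      have h2 : hom μ w p 0 = p 0 := by
        have := mul_eq_zero.1 (show (q 1 - p 1) * (hom μ w p 0 - p 0) = 0 by linarith)
        rcases this with h | h
        · exact absurd h h1
        · linarith
      refine ⟨(hom μ w p 1 - p 1) / (q 1 - p 1), eq_of_coords ?_ ?_⟩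
      · simp only [PiLp.add_apply, PiLp.smul_apply, PiLp.sub_apply, smul_eq_mul, h0, h2]; ring
      · simp only [PiLp.add_apply, PiLp.smul_apply, PiLp.sub_apply, smul_eq_mul]
        field_simp; ring
    · refine ⟨(hom μ w p 0 - p 0) / (q 0 - p 0), eq_of_coords ?_ ?_⟩
      · simp only [PiLp.add_apply, PiLp.smul_apply, PiLp.sub_apply, smul_eq_mul]
        field_simp; ring
      · simp only [PiLp.add_apply, PiLp.smul_apply, PiLp.sub_apply, smul_eq_mul]
        field_simp; linarith
  have hw : ∀ z, hom μ w z = p + t • (q - p) + μ • (z - p) := by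
    intro z
    rw [← ht]
    ext i
    simp only [hom_apply, PiLp.add_apply, PiLp.smul_apply, PiLp.sub_apply, smul_eq_mul]
    ring
  -- a point strictly between two points of the line in `T` is interior
  have mid : ∀ a b c : ℝ, p + a • (q - p) ∈ T → p + c • (q - p) ∈ T → a < b → b < c →
      p + b • (q - p) ∈ interior T := by
    intro a b c ha hc hab hbc
    have hne : p + a • (q - p) ≠ p + c • (q - p) := by
      intro e
      have h1 : (c - a) • (q - p) = 0 := by
        rw [sub_smul]; exact sub_eq_zero.2 (add_left_cancel e).symm
      rcases smul_eq_zero.1 h1 with h | h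
      · linarith
      · exact hpq (sub_eq_zero.1 h).symm
    have hac : 0 < c - a := by linarith
    have := hT ha hc hne (a := (c - b) / (c - a)) (b := (b - a) / (c - a))
      (div_pos (by linarith) hac) (div_pos (by linarith) hac) (by field_simp; ring)
    convert this using 1
    ext i
    simp only [PiLp.add_apply, PiLp.smul_apply, PiLp.sub_apply, smul_eq_mul]
    field_simp
    ring
  have e0 : p + (0 : ℝ) • (q - p) = p := by simp
  have e1 : p + (1 : ℝ) • (q - p) = q := by simp
  have et : p + t • (q - p) = hom μ w p := ht.symm
  have es : p + (t + μ) • (q - p) = hom μ w q := by rw [hw]; module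
  have i1 := mid 0 1 (t + μ)
  have i2 := mid 0 (t + μ) 1
  have i4 := mid t 0 1
  have i7 := mid 0 t (t + μ)
  rw [e0, e1, es] at i1 i2
  rw [e0, e1, et] at i4
  rw [e0, et, es] at i7
  have ht0 : t = 0 := by
    rcases lt_trichotomy t 0 with h | h | h
    · exact absurd (i4 hp' hq h one_pos) hpn
    · exact h
    · exact absurd (i7 hp hq' h (by linarith)) hpi
  have hμ1 : μ = 1 := by
    rcases lt_trichotomy μ 1 with h | h | h
    · exact absurd (i2 hp hq (by linarith) (by linarith)) hqi
    · exact h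
    · exact absurd (i1 hp hq' (by linarith) (by linarith)) hqn
  intro z
  rw [hw, ht0, hμ1]
  module

/-- Two ranges that share two boundary points are nested on either side of the common chord, in
opposite ways. -/
theorem isRange_nested {S T₁ T₂ : Set Pt} (hSc : StrictConvex ℝ S) (hSk : IsCompact S)
    (h₁ : IsRange S T₁) (h₂ : IsRange S T₂) {p q : Pt} (hpq : p ≠ q)
    (hp₁ : p ∈ frontier T₁) (hq₁ : q ∈ frontier T₁) (hp₂ : p ∈ frontier T₂)
    (hq₂ : q ∈ frontier T₂) :
    T₁ = T₂ ∨
      ((∀ z ∈ T₂, 0 < det p q z → z ∈ interior T₁) ∧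
        ∀ z ∈ T₁, det p q z < 0 → z ∈ interior T₂) ∨
      ((∀ z ∈ T₁, 0 < det p q z → z ∈ interior T₂) ∧
        ∀ z ∈ T₂, det p q z < 0 → z ∈ interior T₁) := by
  obtain ⟨μ, w, hμ, e₂⟩ := exists_preimage_of_isRange h₁ h₂
  have hμ' : μ ≠ 0 := hμ.ne'
  set ν := μ⁻¹ with hν
  set u := -(μ⁻¹ • w) with hu
  have hν0 : 0 < ν := inv_pos.2 hμ
  have e₁ : T₁ = hom ν u ⁻¹' T₂ := by
    rw [e₂, ← Set.preimage_comp]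
    have : hom μ w ∘ hom ν u = id := funext fun z => hom_hom_inv hμ' w z
    rw [this, Set.preimage_id]
  have sc₁ := h₁.strictConvex hSc
  have sc₂ := h₂.strictConvex hSc
  have cl₁ := (h₁.isCompact hSk).isClosed
  have cl₂ := (h₂.isCompact hSk).isClosed
  have t₁ : ∀ {z}, z ∈ frontier T₁ → z ∈ T₁ := fun h => cl₁.frontier_subset h
  have t₂ : ∀ {z}, z ∈ frontier T₂ → z ∈ T₂ := fun h => cl₂.frontier_subset h
  have hp' : hom μ w p ∈ frontier T₁ := by
    rwa [e₂, mem_frontier_preimage_hom hμ'] at hp₂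
  have hq' : hom μ w q ∈ frontier T₁ := by
    rwa [e₂, mem_frontier_preimage_hom hμ'] at hq₂
  have hp'' : hom ν u p ∈ frontier T₂ := by
    rwa [e₁, mem_frontier_preimage_hom hν0.ne'] at hp₁
  have hq'' : hom ν u q ∈ frontier T₂ := by
    rwa [e₁, mem_frontier_preimage_hom hν0.ne'] at hq₁
  have m₁ : ∀ z ∈ T₁, hom ν u z ∈ T₂ := fun z hz => by rw [e₁] at hz; exact hz
  have m₂ : ∀ z ∈ T₂, hom μ w z ∈ T₁ := fun z hz => by rw [e₂] at hz; exact hz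
  have hdet : det p q (hom ν u p) = - ν * det p q (hom μ w p) := by
    simp only [det, hom_apply, hν, hu, PiLp.neg_apply, PiLp.smul_apply, smul_eq_mul]
    field_simp
    ring
  have hdet' : det p q (hom μ w q) = det p q (hom μ w p) := by
    simp only [det, hom_apply]; ring
  have hdet'' : det p q (hom ν u q) = det p q (hom ν u p) := by
    simp only [det, hom_apply]; ring
  rcases lt_trichotomy (det p q (hom μ w p)) 0 with h | h | h
  · right; right
    constructor
    · intro z hz hd
      refine mem_interior_of_hom_mem sc₂ hν0 (t₂ hp₂) (t₂ hq₂) (t₂ hp'') (t₂ hq'') hp''.2 hq''.2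
        ?_ (m₁ z hz) hd
      rw [hdet]; nlinarith
    · intro z hz hd
      refine mem_interior_of_hom_mem sc₁ hμ (t₁ hq₁) (t₁ hp₁) (t₁ hq') (t₁ hp') hq'.2 hp'.2
        ?_ (m₂ z hz) ?_
      · rw [det_swap, hdet']; linarith
      · rw [det_swap]; linarith
  · left
    have := hom_eq_self_of_collinear sc₁ hμ hpq (t₁ hp₁) (t₁ hq₁) (t₁ hp') (t₁ hq') hp₁.2 hq₁.2
      hp'.2 hq'.2 h
    rw [e₂]
    ext z
    rw [Set.mem_preimage, this]
  · right; left
    constructor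
    · intro z hz hd
      exact mem_interior_of_hom_mem sc₁ hμ (t₁ hp₁) (t₁ hq₁) (t₁ hp') (t₁ hq') hp'.2 hq'.2
        h (m₂ z hz) hd
    · intro z hz hd
      refine mem_interior_of_hom_mem sc₂ hν0 (t₂ hq₂) (t₂ hp₂) (t₂ hq'') (t₂ hp'') hq''.2 hp''.2
        ?_ (m₁ z hz) ?_
      · rw [det_swap, hdet'', hdet]; nlinarith
      · rw [det_swap]; linarith

theorem isRange_nested_of_mem {S T₁ T₂ : Set Pt} (hSc : StrictConvex ℝ S) (hSk : IsCompact S)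
    (h₁ : IsRange S T₁) (h₂ : IsRange S T₂) (hne : T₁ ≠ T₂) {p q y : Pt}
    (hp₁ : p ∈ frontier T₁) (hq₁ : q ∈ frontier T₁) (hp₂ : p ∈ frontier T₂)
    (hq₂ : q ∈ frontier T₂) (hy₁ : y ∈ T₁) (hy₂ : y ∉ interior T₂) (hy : 0 < det p q y) :
    (∀ z ∈ T₂, 0 < det p q z → z ∈ interior T₁) ∧
      ∀ z ∈ T₁, det p q z < 0 → z ∈ interior T₂ := by
  rcases isRange_nested hSc hSk h₁ h₂ (ne_of_det_ne hy.ne').1 hp₁ hq₁ hp₂ hq₂ with h | h | h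
  · exact absurd h hne
  · exact h
  · exact absurd (h.1 y hy₁ hy) hy₂

theorem isRange_eq_of_three {S T₁ T₂ : Set Pt} (hSc : StrictConvex ℝ S) (hSk : IsCompact S)
    (h₁ : IsRange S T₁) (h₂ : IsRange S T₂) {p q r s : Pt}
    (hp₁ : p ∈ frontier T₁) (hq₁ : q ∈ frontier T₁) (hp₂ : p ∈ frontier T₂)
    (hq₂ : q ∈ frontier T₂) (hr₁ : r ∈ T₁) (hr₂ : r ∉ interior T₂)
    (hs₂ : s ∈ T₂) (hs₁ : s ∉ interior T₁) (hr : 0 < det p q r) (hs : 0 < det p q s) :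
    T₁ = T₂ := by
  by_contra hne
  exact hs₁ ((isRange_nested_of_mem hSc hSk h₁ h₂ hne hp₁ hq₁ hp₂ hq₂ hr₁ hr₂ hr).1 s hs₂ hs)
/-- The linear functional with coefficients `a`, `b`. -/
def lin (a b : ℝ) : Pt →ₗ[ℝ] ℝ where
  toFun z := a * z 0 + b * z 1
  map_add' x y := by simp only [PiLp.add_apply]; ring
  map_smul' c x := by simp only [PiLp.smul_apply, smul_eq_mul, RingHom.id_apply]; ring

theorem lin_apply (a b : ℝ) (z : Pt) : lin a b z = a * z 0 + b * z 1 := rfl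

theorem lin_ne_zero {a b : ℝ} (h : a ≠ 0 ∨ b ≠ 0) : lin a b ≠ 0 := by
  intro e
  have h0 : lin a b !₂[1, 0] = 0 := by rw [e]; rfl
  have h1 : lin a b !₂[0, 1] = 0 := by rw [e]; rfl
  simp [lin_apply] at h0 h1
  tauto

/-- An interior point can be moved a little in any direction. -/
theorem exists_pos_add_smul_mem {T : Set Pt} {z : Pt} (hz : z ∈ interior T) (u : Pt) :
    ∃ δ : ℝ, 0 < δ ∧ z + δ • u ∈ T := by
  have hc : Continuous fun δ : ℝ => z + δ • u := by fun_prop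
  have h0 : (fun δ : ℝ => z + δ • u) 0 ∈ interior T := by simpa using hz
  have hev := (hc.continuousAt (x := 0)).eventually (isOpen_interior.mem_nhds h0)
  obtain ⟨δ, hδ, hpos⟩ := ((hev.filter_mono nhdsWithin_le_nhds).and
    (self_mem_nhdsWithin (s := Set.Ioi (0 : ℝ)))).exists
  exact ⟨δ, hpos, interior_subset hδ⟩

theorem NiceShape.interior_nonempty {S : Set Pt} (hS : NiceShape S) : (interior S).Nonempty := by
  obtain ⟨⟨p, hp⟩, hconv, hcomp, htan, hseg⟩ := hS
  by_contra hne
  rw [Set.not_nonempty_iff_eq_empty] at hne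
  have hfr : frontier S = S := by rw [hcomp.isClosed.frontier_eq, hne, Set.sdiff_empty]
  rw [hfr] at htan hseg
  have hsing : S = {p} := by
    ext x
    constructor
    · exact fun hx => hseg x hx p hp (hconv.segment_subset hx hp)
    · rintro rfl; exact hp
  obtain ⟨l, -, huniq⟩ := htan p hp
  have line : ∀ a b : ℝ, (a ≠ 0 ∨ b ≠ 0) → {z | lin a b z = lin a b p} = l := by
    intro a b hab
    refine huniq _ ⟨⟨lin a b, _, lin_ne_zero hab, rfl⟩, ?_⟩
    rw [hsing, Set.inter_eq_right]
    rintro _ rfl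
    rfl
  have heq := (line 1 0 (by simp)).trans (line 0 1 (by simp)).symm
  have hmem : p + !₂[0, 1] ∈ {z | lin 1 0 z = lin 1 0 p} := by simp [lin_apply]
  rw [heq] at hmem
  simp [lin_apply] at hmem

theorem NiceShape.strictConvex {S : Set Pt} (hS : NiceShape S) : StrictConvex ℝ S := by
  have hinterior := hS.interior_nonempty
  obtain ⟨-, hconv, hcomp, -, hseg⟩ := hS
  intro x hx y hy hxy a b ha hb hab
  by_contra hm
  set m := a • x + b • y
  obtain ⟨f, hf⟩ := geometric_hahn_banach_open_point hconv.interior isOpen_interior hm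
  have hle : ∀ z ∈ S, f z ≤ f m := by
    intro z hz
    have hcl : z ∈ closure (interior S) := by
      rw [hconv.closure_interior_eq_closure_of_nonempty_interior hinterior]
      exact subset_closure hz
    exact closure_minimal (fun z hz => (hf z hz).le) (isClosed_le f.continuous continuous_const) hcl
  have hfm : f m = a * f x + b * f y := by simp [m]
  have hfx := hle x hx
  have hfy := hle y hy
  have hsum : a * (f m - f x) + b * (f m - f y) = 0 := by
    linear_combination (f m) * hab + hfm
  have ex : f x = f m := by
    refine hfx.eq_of_not_lt fun h => ?_
    have := mul_pos ha (sub_pos.2 h)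
    have := mul_nonneg hb.le (sub_nonneg.2 hfy)
    linarith
  have ey : f y = f m := by
    refine hfy.eq_of_not_lt fun h => ?_
    have := mul_pos hb (sub_pos.2 h)
    have := mul_nonneg ha.le (sub_nonneg.2 hfx)
    linarith
  refine hxy (hseg x ?_ y ?_ ?_)
  · exact ⟨subset_closure hx, fun h => absurd ex (hf x h).ne⟩
  · exact ⟨subset_closure hy, fun h => absurd ey (hf y h).ne⟩
  · rintro z ⟨c, c', hc, hc', hcc, rfl⟩
    refine ⟨subset_closure (hconv hx hy hc hc' hcc), fun h => absurd ?_ (hf _ h).ne⟩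
    simp only [map_add, map_smul, smul_eq_mul, ex, ey]
    rw [← add_mul, hcc, one_mul]

/-- Smoothness at the extreme point of a nice shape in the direction transverse to `d`: every
downward direction stays in the shape for a while. -/
theorem NiceShape.exists_top {S : Set Pt} (hS : NiceShape S) {d e : Pt}
    (hΔ : d 0 * e 1 - d 1 * e 0 ≠ 0) :
    ∃ s y : ℝ, s • d + y • e ∈ S ∧ (∀ s' y' : ℝ, s' • d + y' • e ∈ S → y' ≤ y) ∧
      ∀ κ : ℝ, ∃ ε > 0, ∀ ε', 0 ≤ ε' → ε' ≤ ε → (s + ε' * κ) • d + (y - ε') • e ∈ S := by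
  have hsc := hS.strictConvex
  obtain ⟨hne, hconv, hcomp, htan, -⟩ := hS
  set Δ := d 0 * e 1 - d 1 * e 0 with hΔdef
  set Y : Pt →ₗ[ℝ] ℝ := lin (-d 1 / Δ) (d 0 / Δ) with hY
  set X : Pt →ₗ[ℝ] ℝ := lin (e 1 / Δ) (-e 0 / Δ) with hX
  have hYP : ∀ s y : ℝ, Y (s • d + y • e) = y := by
    intro s y
    simp only [hY, lin_apply, PiLp.add_apply, PiLp.smul_apply, smul_eq_mul]
    field_simp
    rw [hΔdef]; ring
  have hcoord : ∀ z : Pt, z = X z • d + Y z • e := by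
    intro z
    apply eq_of_coords <;>
    · simp only [hY, hX, lin_apply, PiLp.add_apply, PiLp.smul_apply, smul_eq_mul]
      field_simp
      rw [hΔdef]; ring
  have hY0 : Y ≠ 0 := by
    intro h
    have := hYP 0 1
    rw [h] at this
    simp at this
  have hYc : Continuous Y := Y.continuous_of_finiteDimensional
  obtain ⟨t, htS, htmax⟩ := hcomp.exists_isMaxOn hne hYc.continuousOn
  have htmax : ∀ z ∈ S, Y z ≤ Y t := fun z hz => htmax hz
  have hYe : Y e = 1 := by simpa using hYP 0 1
  have hnotint : ∀ z, Y z = Y t → z ∉ interior S := by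
    intro z hz hzi
    obtain ⟨δ, hδ, hm⟩ := exists_pos_add_smul_mem hzi e
    have := htmax _ hm
    rw [map_add, map_smul, hYe, hz, smul_eq_mul] at this
    linarith
  have huniq : ∀ z ∈ S, Y z = Y t → z = t := by
    intro z hz hzt
    by_contra hne
    refine hnotint _ ?_ (hsc hz htS hne (a := 1 / 2) (b := 1 / 2) (by norm_num) (by norm_num)
      (by norm_num))
    rw [map_add, map_smul, map_smul, hzt, smul_eq_mul]; ring
  obtain ⟨l, -, hl⟩ := htan t ⟨subset_closure htS, hnotint t rfl⟩
  have hl₁ : {z | Y z = Y t} = l := by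
    refine hl _ ⟨⟨Y, _, hY0, rfl⟩, ?_⟩
    ext z
    constructor
    · rintro ⟨h1, h2⟩; exact huniq z h2 h1
    · rintro rfl; exact ⟨rfl, htS⟩
  refine ⟨X t, Y t, by rw [← hcoord]; exact htS, fun s' y' h => ?_, fun κ => ?_⟩
  · have := htmax _ h
    rwa [hYP] at this
  set u : Pt := κ • d - e with hu
  have hYu : Y u = -1 := by
    have := hYP κ (-1)
    rw [neg_one_smul, ← sub_eq_add_neg] at this
    exact this
  set G : Pt →ₗ[ℝ] ℝ := lin (u 1) (-u 0) with hG
  have hGu : G u = 0 := by simp only [hG, lin_apply]; ring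
  have hG0 : G ≠ 0 := by
    apply lin_ne_zero
    by_contra! h
    have : u = 0 := eq_of_coords (by simpa using h.2) (by simpa using h.1)
    rw [this, map_zero] at hYu
    norm_num at hYu
  have hex : ∃ z ∈ S, G z = G t ∧ z ≠ t := by
    by_contra! h
    have hl₂ : {z | G z = G t} = l := by
      refine hl _ ⟨⟨G, _, hG0, rfl⟩, ?_⟩
      ext z
      constructor
      · rintro ⟨h1, h2⟩; exact h z h2 h1
      · rintro rfl; exact ⟨rfl, htS⟩
    have hmem : t + u ∈ {z | G z = G t} := by simp [hGu]
    rw [hl₂, ← hl₁, Set.mem_ofPred_eq, map_add, hYu] at hmem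
    linarith
  obtain ⟨z, hzS, hGz, hzt⟩ := hex
  set ε := Y t - Y z with hε
  have hz : X z = X t + ε * κ := by
    have h1 : G z = -Δ * (κ * Y z + X z) := by
      conv_lhs => rw [hcoord z]
      simp only [hG, hu, lin_apply, PiLp.add_apply, PiLp.smul_apply, PiLp.sub_apply, smul_eq_mul]
      rw [hΔdef]; ring
    have h2 : G t = -Δ * (κ * Y t + X t) := by
      conv_lhs => rw [hcoord t]
      simp only [hG, hu, lin_apply, PiLp.add_apply, PiLp.smul_apply, PiLp.sub_apply, smul_eq_mul]
      rw [hΔdef]; ring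
    rw [h1, h2] at hGz
    have := mul_left_cancel₀ (neg_ne_zero.2 hΔ) hGz
    rw [hε]; linarith
  have hεpos : 0 < ε := by
    rcases (sub_nonneg.2 (htmax z hzS)).lt_or_eq with h | h
    · exact h
    · exact absurd (huniq z hzS (by linarith)) hzt
  refine ⟨ε, hεpos, fun ε' h0 h1 => ?_⟩
  have hz' : z = (X t + ε * κ) • d + (Y t - ε) • e := by
    conv_lhs => rw [hcoord z, hz]
    rw [hε]; congr 2; ring
  have key : (X t + ε' * κ) • d + (Y t - ε') • e = (1 - ε' / ε) • (X t • d + Y t • e) +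
      (ε' / ε) • ((X t + ε * κ) • d + (Y t - ε) • e) := by
    have hk : ε' = ε' / ε * ε := by field_simp
    generalize ε' / ε = θ at hk
    rw [hk]
    module
  rw [key, ← hcoord t, ← hz']
  exact hconv htS hzS (sub_nonneg.2 ((div_le_one hεpos).2 h1)) (by positivity) (by ring)

theorem exists_mem_frontier_of_isPreconnected {s t : Set Pt} (ht : IsClosed t)
    (hs : IsPreconnected s) (h₁ : (s ∩ t).Nonempty) (h₂ : (s ∩ tᶜ).Nonempty) :
    (s ∩ frontier t).Nonempty := by
  by_contra hne
  have hdich : ∀ z ∈ s, z ∈ t → z ∈ interior t := fun z hz hzt => by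
    by_contra hzi
    exact hne ⟨z, hz, subset_closure hzt, hzi⟩
  obtain ⟨z, hz, hzt⟩ := h₁
  obtain ⟨z', -, h₃, h₄⟩ := hs (interior t) tᶜ isOpen_interior ht.isOpen_compl
    (fun y hy => (em (y ∈ t)).imp (hdich y hy) id) ⟨z, hz, hdich z hz hzt⟩ h₂
  exact h₄ (interior_subset h₃)

/-- Every triangle has a homothetic copy inscribed in a nice shape. -/
theorem NiceShape.exists_inscribed {S : Set Pt} (hS : NiceShape S) {d e : Pt}
    (hΔ : d 0 * e 1 - d 1 * e 0 ≠ 0) :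
    ∃ (μ : ℝ) (z : Pt), 0 < μ ∧ z ∈ frontier S ∧ z + μ • d ∈ frontier S ∧
      z + μ • e ∈ frontier S := by
  have hsc := hS.strictConvex
  have hconv := hsc.convex
  have hcomp : IsCompact S := hS.2.2.1
  obtain ⟨st, yt, htS, htmax, htop⟩ := hS.exists_top hΔ
  obtain ⟨sb, yb, hbS, hbmin, hbot⟩ : ∃ s y : ℝ, s • d + y • e ∈ S ∧
      (∀ s' y' : ℝ, s' • d + y' • e ∈ S → y ≤ y') ∧
      ∀ κ : ℝ, ∃ ε > 0, ∀ ε', 0 ≤ ε' → ε' ≤ ε → (s + ε' * κ) • d + (y + ε') • e ∈ S := by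
    have hΔ' : d 0 * (-e) 1 - d 1 * (-e) 0 ≠ 0 := by
      simp only [PiLp.neg_apply]
      intro h; apply hΔ; linarith
    obtain ⟨s, y, h1, h2, h3⟩ := hS.exists_top hΔ'
    refine ⟨s, -y, by simpa using h1, fun s' y' h => ?_, fun κ => ?_⟩
    · have := h2 s' (-y') (by simpa using h)
      linarith
    · obtain ⟨ε, hε, h⟩ := h3 κ
      refine ⟨ε, hε, fun ε' a b => ?_⟩
      convert h ε' a b using 2
      module
  have hcombo : ∀ {s y s' y' a b : ℝ}, s • d + y • e ∈ S → s' • d + y' • e ∈ S → 0 ≤ a → 0 ≤ b →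
      a + b = 1 → (a * s + b * s') • d + (a * y + b * y') • e ∈ S := by
    intro s y s' y' a b h h' ha hb hab
    convert hconv h h' ha hb hab using 1
    module
  have hd0 : d ≠ 0 := by
    rintro rfl
    simp at hΔ
  -- the slice at height `y`
  set Λ : ℝ → Set ℝ := fun y => {s | s • d + y • e ∈ S} with hΛ
  have hΛcomp : ∀ y, IsCompact (Λ y) := by
    intro y
    have hce : Topology.IsClosedEmbedding fun s : ℝ => s • d + y • e := by
      exact (Homeomorph.addRight (y • e)).isClosedEmbedding.comp (isClosedEmbedding_smul_left hd0)
    exact hce.isCompact_preimage hcomp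
  have hyt : ∃ ε, 0 < ε ∧ yb < yt - ε ∧ (st + ε) • d + (yt - ε) • e ∈ S ∧
      (st - ε) • d + (yt - ε) • e ∈ S := by
    obtain ⟨ε₁, h₁, k₁⟩ := htop 1
    obtain ⟨ε₂, h₂, k₂⟩ := htop (-1)
    have hε : 0 < min ε₁ ε₂ := lt_min h₁ h₂
    have hl := min_le_left ε₁ ε₂
    have hr := min_le_right ε₁ ε₂
    refine ⟨min ε₁ ε₂ / 2, by linarith, ?_, ?_, ?_⟩
    · have := hbmin _ _ (k₁ _ hε.le hl)
      linarith
    · have := k₁ (min ε₁ ε₂ / 2) (by linarith) (by linarith)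
      rwa [mul_one] at this
    · have := k₂ (min ε₁ ε₂ / 2) (by linarith) (by linarith)
      rwa [mul_neg_one, ← sub_eq_add_neg] at this
  obtain ⟨ε, hε, hyε, hεr, hεl⟩ := hyt
  have hyy : yb < yt := by linarith
  set I := Set.Ioo yb yt with hI
  set α : ℝ → ℝ := fun y => sInf (Λ y) with hα
  set β : ℝ → ℝ := fun y => sSup (Λ y) with hβ
  have hαle : ∀ {s y : ℝ}, s • d + y • e ∈ S → α y ≤ s := fun {s y} h =>
    csInf_le (hΛcomp y).bddBelow h
  have hleβ : ∀ {s y : ℝ}, s • d + y • e ∈ S → s ≤ β y := fun {s y} h =>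
    le_csSup (hΛcomp y).bddAbove h
  have hmid : ∀ y ∈ I, ∃ s : ℝ, s • d + y • e ∈ interior S := by
    rintro y ⟨h1, h2⟩
    have hpos : 0 < yt - yb := by linarith
    have hne : st • d + yt • e ≠ sb • d + yb • e := by
      intro h
      rw [h] at htS
      obtain ⟨ε₁, h₁, k₁⟩ := hbot 0
      have c0 := congrArg (fun z : Pt => d 0 * z 1 - d 1 * z 0) h
      simp only [PiLp.add_apply, PiLp.smul_apply, smul_eq_mul] at c0
      have : (yt - yb) * (d 0 * e 1 - d 1 * e 0) = 0 := by linear_combination c0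
      rcases mul_eq_zero.1 this with h | h
      · linarith
      · exact hΔ h
    have := hsc htS hbS hne (a := (y - yb) / (yt - yb)) (b := (yt - y) / (yt - yb))
      (div_pos (by linarith) hpos) (div_pos (by linarith) hpos) (by field_simp; ring)
    refine ⟨(y - yb) / (yt - yb) * st + (yt - y) / (yt - yb) * sb, ?_⟩
    convert this using 1
    have hy : y = (y - yb) / (yt - yb) * yt + (yt - y) / (yt - yb) * yb := by
      field_simp; ring
    conv_lhs => rw [show y • e = ((y - yb) / (yt - yb) * yt + (yt - y) / (yt - yb) * yb) • e by
      rw [← hy]]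
    module
  have hΛne : ∀ y ∈ I, (Λ y).Nonempty := fun y hy => by
    obtain ⟨s, hs⟩ := hmid y hy
    exact ⟨s, show s • d + y • e ∈ S from interior_subset hs⟩
  have hαmem : ∀ y ∈ I, α y • d + y • e ∈ S := fun y hy => (hΛcomp y).sInf_mem (hΛne y hy)
  have hβmem : ∀ y ∈ I, β y • d + y • e ∈ S := fun y hy => (hΛcomp y).sSup_mem (hΛne y hy)
  have hαfr : ∀ y ∈ I, α y • d + y • e ∈ frontier S := by
    refine fun y hy => ⟨subset_closure (hαmem y hy), fun h => ?_⟩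
    obtain ⟨δ, hδ, hm⟩ := exists_pos_add_smul_mem h (-d)
    have := hαle (s := α y - δ) (y := y) (by convert hm using 1; module)
    linarith
  have hβfr : ∀ y ∈ I, β y • d + y • e ∈ frontier S := by
    refine fun y hy => ⟨subset_closure (hβmem y hy), fun h => ?_⟩
    obtain ⟨δ, hδ, hm⟩ := exists_pos_add_smul_mem h d
    have := hleβ (s := β y + δ) (y := y) (by convert hm using 1; module)
    linarith
  have hαβ : ∀ y ∈ I, α y < β y := by
    intro y hy
    obtain ⟨s, hs⟩ := hmid y hy
    obtain ⟨δ, hδ, hm⟩ := exists_pos_add_smul_mem hs d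
    have h1 := hαle (interior_subset hs)
    have h2 := hleβ (s := s + δ) (y := y) (by convert hm using 1; module)
    linarith
  have hαconv : ConvexOn ℝ I α := by
    refine ⟨convex_Ioo _ _, fun y hy y' hy' a b ha hb hab => ?_⟩
    exact hαle (hcombo (hαmem y hy) (hαmem y' hy') ha hb hab)
  have hβconc : ConcaveOn ℝ I β := by
    refine ⟨convex_Ioo _ _, fun y hy y' hy' a b ha hb hab => ?_⟩
    exact hleβ (hcombo (hβmem y hy) (hβmem y' hy') ha hb hab)
  have hαc : ContinuousOn α I := hαconv.continuousOn isOpen_Ioo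
  have hβc : ContinuousOn β I := hβconc.continuousOn isOpen_Ioo
  set γ : ℝ → Pt := fun y => α y • d + (y + (β y - α y)) • e with hγ
  have hγc : ContinuousOn γ I :=
    (hαc.smul continuousOn_const).add ((continuousOn_id.add (hβc.sub hαc)).smul continuousOn_const)
  -- near the top the third vertex is outside
  have hout : ∃ y ∈ I, γ y ∉ S := by
    refine ⟨yt - ε, ⟨hyε, by linarith⟩, fun h => ?_⟩
    have h1 := htmax _ _ h
    have h2 := hαle hεl
    have h3 := hleβ hεr
    linarith
  -- near the bottom it is inside
  have hin : ∃ y ∈ I, γ y ∈ S := by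
    obtain ⟨ε₁, h₁, k₁⟩ := hbot 2
    obtain ⟨ε₂, h₂, k₂⟩ := hbot (-2)
    set ε₀ := min ε₁ ε₂ with hε₀
    have hε₀pos : 0 < ε₀ := lt_min h₁ h₂
    have hl : ε₀ ≤ ε₁ := min_le_left ε₁ ε₂
    have hr : ε₀ ≤ ε₂ := min_le_right ε₁ ε₂
    have htri : ∀ s h : ℝ, 0 < h → h ≤ ε₀ → |s| ≤ 2 * h →
        (sb + s) • d + (yb + h) • e ∈ S := by
      intro s h hh hhε hs
      obtain ⟨ha, hb⟩ := abs_le.1 hs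
      have := hcombo (k₁ h hh.le (hhε.trans hl)) (k₂ h hh.le (hhε.trans hr))
        (a := (2 * h + s) / (4 * h)) (b := (2 * h - s) / (4 * h))
        (div_nonneg (by linarith) (by linarith)) (div_nonneg (by linarith) (by linarith))
        (by field_simp; ring)
      convert this using 3 <;> field_simp <;> ring
    set δ := ε₀ / 2 with hδ
    have hδpos : 0 < δ := by positivity
    -- chords close to the bottom are short
    have hshort : ∃ η > 0, ∀ s y : ℝ, s • d + y • e ∈ S → (s + δ) • d + y • e ∈ S →
        yb + η ≤ y := by
      set K : Set Pt := S ∩ (fun z => z + δ • d) ⁻¹' S with hK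
      have hKc : IsCompact K :=
        hcomp.inter_right (hcomp.isClosed.preimage (by fun_prop))
      rcases K.eq_empty_or_nonempty with hKe | hKn
      · refine ⟨1, one_pos, fun s y h h' => ?_⟩
        have : s • d + y • e ∈ K := ⟨h, by
          change s • d + y • e + δ • d ∈ S
          convert h' using 1; module⟩
        rw [hKe] at this
        exact this.elim
      · set Δ := d 0 * e 1 - d 1 * e 0 with hΔdef
        set Y : Pt →ₗ[ℝ] ℝ := lin (-d 1 / Δ) (d 0 / Δ) with hY
        set X : Pt →ₗ[ℝ] ℝ := lin (e 1 / Δ) (-e 0 / Δ) with hX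
        have hYP : ∀ s y : ℝ, Y (s • d + y • e) = y := by
          intro s y
          simp only [hY, lin_apply, PiLp.add_apply, PiLp.smul_apply, smul_eq_mul]
          field_simp
          rw [hΔdef]; ring
        have hcoord : ∀ z : Pt, z = X z • d + Y z • e := by
          intro z
          apply eq_of_coords <;>
          · simp only [hY, hX, lin_apply, PiLp.add_apply, PiLp.smul_apply, smul_eq_mul]
            field_simp
            rw [hΔdef]; ring
        obtain ⟨z, hzK, hzmin⟩ := hKc.exists_isMinOn hKn
          (Y.continuous_of_finiteDimensional).continuousOn
        have hlt : yb < Y z := by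
          have hz1 : z ∈ S := hzK.1
          have hz2 : z + δ • d ∈ S := hzK.2
          have hne : z ≠ z + δ • d := by
            intro h
            rcases smul_eq_zero.1 (left_eq_add.1 h) with h | h
            · linarith
            · exact hd0 h
          have hm := hsc hz1 hz2 hne (a := 1 / 2) (b := 1 / 2) (by norm_num) (by norm_num)
            (by norm_num)
          obtain ⟨θ, hθ, hθm⟩ := exists_pos_add_smul_mem hm (-e)
          have := hbmin (X z + δ / 2) (Y z - θ) (by
            convert hθm using 1
            conv_rhs => rw [hcoord z]
            generalize X z = x
            generalize Y z = y
            module)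
          linarith
        refine ⟨Y z - yb, by linarith, fun s y h h' => ?_⟩
        have : s • d + y • e ∈ K := ⟨h, by
          change s • d + y • e + δ • d ∈ S
          convert h' using 1; module⟩
        have h3 : Y z ≤ Y (s • d + y • e) := hzmin this
        rw [hYP] at h3
        linarith
    obtain ⟨η, hη, hηS⟩ := hshort
    set ξ := min (min (η / 2) δ) ((yt - yb) / 2) with hξ
    have hξpos : 0 < ξ := lt_min (lt_min (by linarith) hδpos) (by linarith)
    have hξη : ξ ≤ η / 2 := (min_le_left _ _).trans (min_le_left _ _)
    have hξδ : ξ ≤ δ := (min_le_left _ _).trans (min_le_right _ _)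
    have hξy : ξ ≤ (yt - yb) / 2 := min_le_right _ _
    have hyI : yb + ξ ∈ I := ⟨by linarith, by linarith⟩
    refine ⟨yb + ξ, hyI, ?_⟩
    have hlen : β (yb + ξ) - α (yb + ξ) < δ := by
      by_contra! hge
      have hpos : 0 < β (yb + ξ) - α (yb + ξ) := hδpos.trans_le hge
      have hm := hcombo (hαmem _ hyI) (hβmem _ hyI)
        (a := 1 - δ / (β (yb + ξ) - α (yb + ξ))) (b := δ / (β (yb + ξ) - α (yb + ξ)))
        (sub_nonneg.2 ((div_le_one hpos).2 hge)) (by positivity) (by ring)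
      have := hηS (α (yb + ξ)) (yb + ξ) (hαmem _ hyI) (by
        convert hm using 3
        · field_simp; ring
        · ring)
      linarith
    have hb1 := hαle (htri 0 ξ hξpos (by linarith) (by simp; linarith))
    have hb2 := hleβ (htri 0 ξ hξpos (by linarith) (by simp; linarith))
    have hb3 := hαβ _ hyI
    have := htri (α (yb + ξ) - sb) (ξ + (β (yb + ξ) - α (yb + ξ))) (by linarith) (by linarith)
      (abs_le.2 ⟨by linarith, by linarith⟩)
    convert this using 1
    simp only [hγ]
    module
  obtain ⟨y₁, hy₁, hy₁S⟩ := hout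
  obtain ⟨y₂, hy₂, hy₂S⟩ := hin
  have hpre : IsPreconnected (γ '' I) := isPreconnected_Ioo.image γ hγc
  obtain ⟨_, ⟨y, hy, rfl⟩, hyf⟩ := exists_mem_frontier_of_isPreconnected hcomp.isClosed hpre
    ⟨γ y₂, ⟨y₂, hy₂, rfl⟩, hy₂S⟩ ⟨γ y₁, ⟨y₁, hy₁, rfl⟩, hy₁S⟩
  refine ⟨β y - α y, α y • d + y • e, sub_pos.2 (hαβ y hy), hαfr y hy, ?_, ?_⟩
  · convert hβfr y hy using 1
    module
  · convert hyf using 1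
    simp only [hγ]
    module

/-- Three non-collinear points lie on the boundary of some range. -/
theorem NiceShape.exists_isRange {S : Set Pt} (hS : NiceShape S) {p q r : Pt}
    (h : det p q r ≠ 0) :
    ∃ T, IsRange S T ∧ p ∈ frontier T ∧ q ∈ frontier T ∧ r ∈ frontier T := by
  have hΔ : (q - p) 0 * (r - p) 1 - (q - p) 1 * (r - p) 0 ≠ 0 := by
    simpa [det] using h
  obtain ⟨μ, z, hμ, h₁, h₂, h₃⟩ := hS.exists_inscribed hΔ
  refine ⟨hom μ (z - μ • p) ⁻¹' S, isRange_iff_preimage.2 ⟨μ, _, hμ, rfl⟩, ?_, ?_, ?_⟩ <;>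
    rw [mem_frontier_preimage_hom hμ.ne']
  · convert h₁ using 1
    simp only [hom]; module
  · convert h₂ using 1
    simp only [hom]; module
  · convert h₃ using 1
    simp only [hom]; module

theorem GenPos.mono {S : Set Pt} {X Y : Finset Pt} (h : GenPos S X) (hYX : Y ⊆ X) :
    GenPos S Y := by
  refine ⟨fun p hp q hq => h.1 p (hYX hp) q (hYX hq), fun p hp q hq r hr =>
    h.2.1 p (hYX hp) q (hYX hq) r (hYX hr), fun T hT p₁ p₂ p₃ p₄ h₁ h₂ h₃ h₄ => ?_⟩
  exact h.2.2 T hT p₁ p₂ p₃ p₄ ⟨hYX h₁.1, h₁.2⟩ ⟨hYX h₂.1, h₂.2⟩ ⟨hYX h₃.1, h₃.2⟩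
    ⟨hYX h₄.1, h₄.2⟩

theorem GenPos.det_ne_zero {S : Set Pt} {X : Finset Pt} (h : GenPos S X) {p q r : Pt}
    (hp : p ∈ X) (hq : q ∈ X) (hr : r ∈ X) (hpq : p ≠ q) (hpr : p ≠ r) (hqr : q ≠ r) :
    det p q r ≠ 0 := by
  intro hdet
  apply h.2.1 p hp q hq r hr hpq hpr hqr
  have h0 : q 0 - p 0 ≠ 0 := fun e => h.1 p hp q hq hpq (by linarith)
  rw [collinear_iff_of_mem (p₀ := p) (by simp)]
  refine ⟨q - p, ?_⟩
  rintro z (rfl | rfl | rfl)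
  · exact ⟨0, by simp⟩
  · exact ⟨1, by simp⟩
  · refine ⟨(z 0 - p 0) / (q 0 - p 0), eq_of_coords ?_ ?_⟩ <;>
      simp only [vadd_eq_add, PiLp.add_apply, PiLp.smul_apply, PiLp.sub_apply, smul_eq_mul]
    · field_simp; ring
    · simp only [det] at hdet
      field_simp; linarith

/-- The corner at `x` of the triangle `a x b` contains the vertical direction of sign `τ`. -/
structure Corner (X : Finset Pt) (τ : ℝ) (x a b : Pt) : Prop where
  mem_left : a ∈ X
  mem_right : b ∈ X
  left : τ * (a 0 - x 0) < 0
  right : 0 < τ * (b 0 - x 0)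
  det_pos : 0 < det a x b

/-- `T` is an empty range through the corner `a x b`. -/
structure CornerRange (S : Set Pt) (X : Finset Pt) (τ : ℝ) (x a b : Pt) (T : Set Pt) : Prop
    extends Corner X τ x a b where
  isRange : IsRange S T
  left_mem : a ∈ frontier T
  mid_mem : x ∈ frontier T
  right_mem : b ∈ frontier T
  inter_eq : (X : Set Pt) ∩ T = {a, x, b}

/-- `x` has a corner containing the vertical direction of sign `τ`. -/
def Covered (X : Finset Pt) (τ : ℝ) (x : Pt) : Prop := ∃ a b, Corner X τ x a b

theorem mem_interior_of_right_below {T : Set Pt} (hT : StrictConvex ℝ T) {τ : ℝ} {x a b y : Pt}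
    (ha : a ∈ T) (hb : b ∈ T) (hy : y ∈ T) (hal : τ * (a 0 - x 0) < 0)
    (hbr : 0 < τ * (b 0 - x 0)) (hyr : 0 < τ * (y 0 - x 0)) (hd : 0 < det a x b)
    (hdy : det a x y ≤ 0) : x ∈ interior T := by
  have e₁ : det x b a = det a x b := by simp only [det]; ring
  have e₂ : det y x a = - det a x y := by simp only [det]; ring
  refine hT.mem_interior_of_det hy hb ha ?_ ?_ ?_
  · linarith
  · linarith
  · have hid : det y b x * (τ * (a 0 - x 0)) + det a x b * (τ * (y 0 - x 0)) +
        (- det a x y) * (τ * (b 0 - x 0)) = 0 := by simp only [det]; ring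
    have h1 := mul_pos hd hyr
    have h2 := mul_nonneg (neg_nonneg.2 hdy) hbr.le
    by_contra! h3
    have h4 := mul_nonneg_of_nonpos_of_nonpos h3 hal.le
    linarith

theorem mem_interior_of_left_below {T : Set Pt} (hT : StrictConvex ℝ T) {τ : ℝ} {x a b y : Pt}
    (ha : a ∈ T) (hb : b ∈ T) (hy : y ∈ T) (hal : τ * (a 0 - x 0) < 0)
    (hbr : 0 < τ * (b 0 - x 0)) (hyl : τ * (y 0 - x 0) < 0) (hd : 0 < det a x b)
    (hdy : det y x b ≤ 0) : x ∈ interior T := by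
  have e₁ : det b a x = det a x b := by simp only [det]; ring
  have e₂ : det b x y = - det y x b := by simp only [det]; ring
  refine hT.mem_interior_of_det hb ha hy ?_ ?_ ?_
  · have hid : det x a y * (τ * (b 0 - x 0)) + det a x b * (τ * (y 0 - x 0)) +
        (- det y x b) * (τ * (a 0 - x 0)) = 0 := by simp only [det]; ring
    have h1 := mul_neg_of_pos_of_neg hd hyl
    have h2 := mul_nonpos_of_nonneg_of_nonpos (neg_nonneg.2 hdy) hal.le
    by_contra! h3
    have h4 := mul_nonpos_of_nonpos_of_nonneg h3 hbr.le
    linarith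
  · linarith
  · linarith

/-- The vertical chord at a corner, as a last point on the vertical ray. -/
theorem exists_chord {T : Set Pt} (hTc : IsCompact T) (hT : Convex ℝ T) {X : Finset Pt} {τ : ℝ}
    (hτ : τ ≠ 0) {x a b : Pt} (hc : Corner X τ x a b) (ha : a ∈ T) (hb : b ∈ T) :
    ∃ s : ℝ, 0 < s ∧ x + s • !₂[0, τ] ∈ T ∧ ∀ s' : ℝ, x + s' • !₂[0, τ] ∈ T → s' ≤ s := by
  set u : Pt := !₂[0, τ] with hu
  have hu0 : u 0 = 0 := by simp [hu]
  have hu1 : u 1 = τ := by simp [hu]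
  have hune : u ≠ 0 := by
    intro h
    rw [h] at hu1
    exact hτ hu1.symm
  have hce : Topology.IsClosedEmbedding fun s : ℝ => x + s • u :=
    (Homeomorph.addLeft x).isClosedEmbedding.comp (isClosedEmbedding_smul_left hune)
  have hl := hc.left
  have hr := hc.right
  have hpos : 0 < τ * (b 0 - a 0) := by linarith
  have hne : b 0 - a 0 ≠ 0 := fun h => by rw [h] at hpos; simp at hpos
  have hs₀ : x + (det a x b / (τ * (b 0 - a 0))) • u ∈ T := by
    have := hT ha hb (a := (τ * (b 0 - x 0)) / (τ * (b 0 - a 0)))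
      (b := -(τ * (a 0 - x 0)) / (τ * (b 0 - a 0))) (div_nonneg hr.le hpos.le)
      (div_nonneg (by linarith) hpos.le) (by field_simp; ring)
    convert this using 1
    apply eq_of_coords <;>
      simp only [PiLp.add_apply, PiLp.smul_apply, smul_eq_mul, hu0, hu1, det] <;>
      field_simp <;> ring
  obtain ⟨s, hsT, hsmax⟩ := (hce.isCompact_preimage hTc).exists_isGreatest ⟨_, hs₀⟩
  exact ⟨s, (div_pos hc.det_pos hpos).trans_le (hsmax hs₀), hsT, fun s' h => hsmax h⟩

theorem det_vertical_left (τ s : ℝ) (x a : Pt) :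
    det a x (x + s • !₂[0, τ]) = -(τ * (a 0 - x 0)) * s := by
  simp [det]; ring

theorem det_vertical_right (τ s : ℝ) (x b : Pt) :
    det x b (x + s • !₂[0, τ]) = (τ * (b 0 - x 0)) * s := by
  simp [det]; ring

/-- A covered point has an empty corner range: the one with shortest vertical chord. -/
theorem exists_cornerRange {S : Set Pt} (hS : NiceShape S) {X : Finset Pt} (hX : GenPos S X)
    {τ : ℝ} (hτ : τ ≠ 0) {x : Pt} (hx : x ∈ X) (hcov : Covered X τ x) :
    ∃ a b T, CornerRange S X τ x a b T := by
  classical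
  have hsc := hS.strictConvex
  have hcomp : IsCompact S := hS.2.2.1
  set u : Pt := !₂[0, τ] with hu
  have hex : ∀ pr : Pt × Pt, Corner X τ x pr.1 pr.2 → ∃ (T : Set Pt) (s : ℝ), IsRange S T ∧
      pr.1 ∈ frontier T ∧ x ∈ frontier T ∧ pr.2 ∈ frontier T ∧ 0 < s ∧ x + s • u ∈ T ∧
      ∀ s' : ℝ, x + s' • u ∈ T → s' ≤ s := by
    rintro ⟨a, b⟩ hc
    obtain ⟨T, hT, h₁, h₂, h₃⟩ := hS.exists_isRange hc.det_pos.ne'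
    have hTc := hT.isCompact hcomp
    obtain ⟨s, hs⟩ := exists_chord hTc (hT.strictConvex hsc).convex hτ hc
      (hTc.isClosed.frontier_subset h₁) (hTc.isClosed.frontier_subset h₃)
    exact ⟨T, s, hT, h₁, h₂, h₃, hs⟩
  choose! T s hT hTa hTx hTb hspos hsT hsmax using hex
  set P := (X ×ˢ X).filter fun pr => Corner X τ x pr.1 pr.2 with hP
  have hPmem : ∀ pr : Pt × Pt, pr ∈ P ↔ Corner X τ x pr.1 pr.2 := by
    intro pr
    simp only [hP, Finset.mem_filter, Finset.mem_product, and_iff_right_iff_imp]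
    exact fun h => ⟨h.mem_left, h.mem_right⟩
  obtain ⟨a₀, b₀, hc₀⟩ := hcov
  obtain ⟨⟨a, b⟩, hab, hmin⟩ := P.exists_min_image s ⟨(a₀, b₀), (hPmem _).2 hc₀⟩
  have hc : Corner X τ x a b := (hPmem _).1 hab
  have hR := hT (a, b) hc
  have hsub := ((hR.isCompact hcomp).isClosed).frontier_subset
  have ha := hTa (a, b) hc
  have hxf := hTx (a, b) hc
  have hb := hTb (a, b) hc
  simp only at ha hb
  -- a pivot towards an interior point would shorten the chord
  have hpivot : ∀ pr : Pt × Pt, Corner X τ x pr.1 pr.2 →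
      x + s pr • u ∈ interior (T (a, b)) → False := by
    intro pr hpr hmem
    obtain ⟨δ, hδ, hm⟩ := exists_pos_add_smul_mem hmem u
    have h1 := hsmax (a, b) hc (s pr + δ) (by convert hm using 1; module)
    have h2 := hmin pr ((hPmem _).2 hpr)
    linarith
  refine ⟨a, b, T (a, b), ⟨hc, hR, ha, hxf, hb, ?_⟩⟩
  apply Set.Subset.antisymm
  · rintro y ⟨hyX, hyT⟩
    have hyX : y ∈ X := hyX
    by_contra hy
    simp only [Set.mem_insert_iff, Set.mem_singleton_iff, not_or] at hy
    obtain ⟨hya, hyx, hyb⟩ := hy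
    obtain ⟨hax, hab', hxb⟩ := ne_of_det_ne hc.det_pos.ne'
    have hyi : y ∈ interior (T (a, b)) := by
      by_contra hyi
      exact hX.2.2 _ hR a x b y ⟨hc.mem_left, ha⟩ ⟨hx, hxf⟩ ⟨hc.mem_right, hb⟩
        ⟨hyX, subset_closure hyT, hyi⟩ hax hab' (Ne.symm hya) hxb (Ne.symm hyx) (Ne.symm hyb)
    have hy0 : τ * (y 0 - x 0) ≠ 0 :=
      mul_ne_zero hτ (sub_ne_zero.2 (hX.1 y hyX x hx hyx))
    rcases hy0.lt_or_gt with hlt | hgt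
    · have hd : 0 < det y x b := by
        by_contra! h
        exact hxf.2 (mem_interior_of_left_below (hR.strictConvex hsc) (hsub ha) (hsub hb) hyT
          hc.left hc.right hlt hc.det_pos h)
      have hc' : Corner X τ x y b := ⟨hyX, hc.mem_right, hlt, hc.right, hd⟩
      have hy' := hTa (y, b) hc'
      refine hpivot (y, b) hc' ((isRange_nested_of_mem hsc hcomp hR (hT (y, b) hc') ?_ hxf hb
        (hTx (y, b) hc') (hTb (y, b) hc') hyT hy'.2 (by rw [det_rotate]; exact hd)).1 _
        (hsT (y, b) hc') ?_)
      · intro h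
        rw [h] at hyi
        exact hy'.2 hyi
      · rw [det_vertical_right]
        exact mul_pos hc.right (hspos (y, b) hc')
    · have hd : 0 < det a x y := by
        by_contra! h
        exact hxf.2 (mem_interior_of_right_below (hR.strictConvex hsc) (hsub ha) (hsub hb) hyT
          hc.left hc.right hgt hc.det_pos h)
      have hc' : Corner X τ x a y := ⟨hc.mem_left, hyX, hc.left, hgt, hd⟩
      have hy' := hTb (a, y) hc'
      refine hpivot (a, y) hc' ((isRange_nested_of_mem hsc hcomp hR (hT (a, y) hc') ?_ ha hxf
        (hTa (a, y) hc') (hTx (a, y) hc') hyT hy'.2 hd).1 _ (hsT (a, y) hc') ?_)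
      · intro h
        rw [h] at hyi
        exact hy'.2 hyi
      · rw [det_vertical_left]
        exact mul_pos (neg_pos.2 hc.left) (hspos (a, y) hc')
  · rintro y (rfl | rfl | rfl)
    · exact ⟨hc.mem_left, hsub ha⟩
    · exact ⟨hx, hsub hxf⟩
    · exact ⟨hc.mem_right, hsub hb⟩

theorem CornerRange.notMem_interior {S T : Set Pt} {X : Finset Pt} {τ : ℝ} {x a b y : Pt}
    (h : CornerRange S X τ x a b T) (hy : y ∈ X) : y ∉ interior T := by
  intro hyi
  have : y ∈ ({a, x, b} : Set Pt) := h.inter_eq ▸ ⟨hy, interior_subset hyi⟩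
  rcases this with rfl | rfl | rfl
  · exact h.left_mem.2 hyi
  · exact h.mid_mem.2 hyi
  · exact h.right_mem.2 hyi

theorem CornerRange.notMem {S T : Set Pt} {X : Finset Pt} {τ : ℝ} {x a b y : Pt}
    (h : CornerRange S X τ x a b T) (hy : y ∈ X) (hya : y ≠ a) (hyx : y ≠ x) (hyb : y ≠ b) :
    y ∉ T := by
  intro hyT
  have : y ∈ ({a, x, b} : Set Pt) := h.inter_eq ▸ ⟨hy, hyT⟩
  rcases this with rfl | rfl | rfl
  · exact hya rfl
  · exact hyx rfl
  · exact hyb rfl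

theorem CornerRange.not_left_below {S T₁ T₂ : Set Pt} (hS : NiceShape S) {X : Finset Pt}
    {τ : ℝ} {x a₁ b₁ a₂ b₂ : Pt} (h₁ : CornerRange S X τ x a₁ b₁ T₁)
    (h₂ : CornerRange S X τ x a₂ b₂ T₂) (hb : b₁ ≠ b₂) : ¬ det a₁ x a₂ < 0 := by
  intro hlt
  have hsc := hS.strictConvex
  have hcomp : IsCompact S := hS.2.2.1
  obtain ⟨hax, haa, hxa⟩ := ne_of_det_ne hlt.ne
  have hxb := (ne_of_det_ne h₂.det_pos.ne').2.2
  have ha₁b₂ : a₁ ≠ b₂ := by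
    rintro rfl
    exact lt_asymm h₁.left h₂.right
  have ha₂b₁ : a₂ ≠ b₁ := by
    rintro rfl
    exact lt_asymm h₂.left h₁.right
  have hd : 0 < det a₁ x b₂ := by
    have hid : det a₁ x b₂ * (τ * (a₂ 0 - x 0)) = det a₂ x b₂ * (τ * (a₁ 0 - x 0)) +
        det a₁ x a₂ * (τ * (b₂ 0 - x 0)) := by simp only [det]; ring
    have k1 := mul_neg_of_pos_of_neg h₂.det_pos h₁.left
    have k2 := mul_neg_of_neg_of_pos hlt h₂.right
    by_contra! k3
    have k4 := mul_nonneg_of_nonpos_of_nonpos k3 h₂.left.le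
    linarith
  obtain ⟨T₃, hT₃, ha, hx, hb₂⟩ := hS.exists_isRange hd.ne'
  have hsub := ((hT₃.isCompact hcomp).isClosed).frontier_subset
  have hsub₂ := ((h₂.isRange.isCompact hcomp).isClosed).frontier_subset
  have n₁ : a₁ ∉ T₂ := h₂.notMem h₁.mem_left haa hax ha₁b₂
  have n₂ : b₂ ∉ T₁ := h₁.notMem h₂.mem_right ha₁b₂.symm hxb.symm hb.symm
  have n₃ : a₂ ∉ T₁ := h₁.notMem h₂.mem_left haa.symm hxa.symm ha₂b₁
  have i₁ : a₂ ∈ interior T₃ :=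
    (isRange_nested_of_mem hsc hcomp hT₃ h₂.isRange (fun h => n₁ (h ▸ hsub ha)) hx hb₂ h₂.mid_mem
      h₂.right_mem (hsub ha) (fun h => n₁ (interior_subset h))
      (by rw [det_rotate]; exact hd)).1 _ (hsub₂ h₂.left_mem)
      (by rw [det_rotate]; exact h₂.det_pos)
  have i₂ : a₂ ∈ interior T₁ :=
    (isRange_nested_of_mem hsc hcomp hT₃ h₁.isRange (fun h => n₂ (h ▸ hsub hb₂)) ha hx h₁.left_mem
      h₁.mid_mem (hsub hb₂) (fun h => n₂ (interior_subset h)) hd).2 _ (interior_subset i₁) hlt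
  exact n₃ (interior_subset i₂)

/-- The empty corner range at a point is unique. -/
theorem CornerRange.unique {S T₁ T₂ : Set Pt} (hS : NiceShape S) {X : Finset Pt}
    (hX : GenPos S X) {τ : ℝ} {x a₁ b₁ a₂ b₂ : Pt} (hx : x ∈ X)
    (h₁ : CornerRange S X τ x a₁ b₁ T₁) (h₂ : CornerRange S X τ x a₂ b₂ T₂) : T₁ = T₂ := by
  have hsc := hS.strictConvex
  have hcomp : IsCompact S := hS.2.2.1
  have hsub₁ := ((h₁.isRange.isCompact hcomp).isClosed).frontier_subset
  have hsub₂ := ((h₂.isRange.isCompact hcomp).isClosed).frontier_subset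
  by_cases ha : a₁ = a₂
  · subst ha
    exact isRange_eq_of_three hsc hcomp h₁.isRange h₂.isRange h₁.left_mem h₁.mid_mem h₂.left_mem
      h₂.mid_mem (hsub₁ h₁.right_mem) (h₂.notMem_interior h₁.mem_right) (hsub₂ h₂.right_mem)
      (h₁.notMem_interior h₂.mem_right) h₁.det_pos h₂.det_pos
  by_cases hb : b₁ = b₂
  · subst hb
    exact isRange_eq_of_three hsc hcomp h₁.isRange h₂.isRange h₁.mid_mem h₁.right_mem h₂.mid_mem
      h₂.right_mem (hsub₁ h₁.left_mem) (h₂.notMem_interior h₁.mem_left) (hsub₂ h₂.left_mem)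
      (h₁.notMem_interior h₂.mem_left) (by rw [det_rotate]; exact h₁.det_pos)
      (by rw [det_rotate]; exact h₂.det_pos)
  have hax₁ := (ne_of_det_ne h₁.det_pos.ne').1
  have hax₂ := (ne_of_det_ne h₂.det_pos.ne').1
  rcases (hX.det_ne_zero h₁.mem_left hx h₂.mem_left hax₁ ha hax₂.symm).lt_or_gt with h | h
  · exact absurd h (h₁.not_left_below hS h₂ hb)
  · refine absurd ?_ (h₂.not_left_below hS h₁ (Ne.symm hb))
    have : det a₂ x a₁ = - det a₁ x a₂ := by simp only [det]; ring
    linarith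

theorem CornerRange.mid_unique {S T : Set Pt} {X : Finset Pt} {τ τ' : ℝ} {x a b x' a' b' : Pt}
    (hx : x ∈ X) (h : CornerRange S X τ x a b T) (h' : CornerRange S X τ' x' a' b' T) :
    x = x' := by
  have heq := h.inter_eq.symm.trans h'.inter_eq
  have hx' : x ∈ ({a', x', b'} : Set Pt) := heq ▸ (by simp)
  have ha : a ∈ ({a', x', b'} : Set Pt) := heq ▸ (by simp)
  have hb : b ∈ ({a', x', b'} : Set Pt) := heq ▸ (by simp)
  have h1 := h.left
  have h2 := h.right
  have h3 := h'.left
  have h4 := h'.right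
  have hneg : (a 0 - x 0) * (b 0 - x 0) < 0 := by
    have h5 := mul_neg_of_neg_of_pos h1 h2
    have h6 : τ * (a 0 - x 0) * (τ * (b 0 - x 0)) = τ ^ 2 * ((a 0 - x 0) * (b 0 - x 0)) := by ring
    by_contra! h7
    have := mul_nonneg (sq_nonneg τ) h7
    linarith
  have hprod : ∀ s t : ℝ, 0 < (τ' * s) * (τ' * t) → 0 < s * t := by
    intro s t hst
    by_contra! h7
    have := mul_nonneg (sq_nonneg τ') (neg_nonneg.2 h7)
    nlinarith
  obtain ⟨hax, -, hxb⟩ := ne_of_det_ne h.det_pos.ne'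
  rcases hx' with rfl | rfl | rfl
  · have key : ∀ y ∈ ({x, x', b'} : Set Pt), y ≠ x → 0 < τ' * (y 0 - x 0) := by
      rintro y (rfl | rfl | rfl) hy
      · exact absurd rfl hy
      · linarith
      · linarith
    exact absurd (hprod _ _ (mul_pos (key a ha hax) (key b hb hxb.symm))) hneg.not_gt
  · rfl
  · have key : ∀ y ∈ ({a', x', x} : Set Pt), y ≠ x → τ' * (y 0 - x 0) < 0 := by
      rintro y (rfl | rfl | rfl) hy
      · linarith
      · linarith
      · exact absurd rfl hy
    exact absurd (hprod _ _ (mul_pos_of_neg_of_neg (key a ha hax) (key b hb hxb.symm)))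
      hneg.not_gt

/-- The empty ranges with a corner of vertical sign `τ`. -/
def cornerRanges (S : Set Pt) (X : Finset Pt) (τ : ℝ) : Set (Set Pt) :=
  {T | ∃ x ∈ X, ∃ a b, CornerRange S X τ x a b T}

theorem ncard_cornerRanges {S : Set Pt} (hS : NiceShape S) {X : Finset Pt} (hX : GenPos S X)
    {τ : ℝ} (hτ : τ ≠ 0) [DecidablePred (Covered X τ)] :
    (cornerRanges S X τ).ncard = (X.filter (Covered X τ)).card := by
  have hex : ∀ x, x ∈ X ∧ Covered X τ x → ∃ T a b, CornerRange S X τ x a b T := by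
    rintro x ⟨hx, hc⟩
    obtain ⟨a, b, T, h⟩ := exists_cornerRange hS hX hτ hx hc
    exact ⟨T, a, b, h⟩
  choose! T a b hT using hex
  have himage : cornerRanges S X τ = T '' (X.filter (Covered X τ) : Finset Pt) := by
    ext T'
    simp only [Set.mem_image, Finset.mem_coe, Finset.mem_filter]
    constructor
    · rintro ⟨x, hx, a', b', h⟩
      have hc : x ∈ X ∧ Covered X τ x := ⟨hx, a', b', h.toCorner⟩
      exact ⟨x, hc, (hT x hc).unique hS hX hx h⟩
    · rintro ⟨x, hc, rfl⟩
      exact ⟨x, hc.1, _, _, hT x hc⟩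
  rw [himage, Set.InjOn.ncard_image, Set.ncard_coe_finset]
  intro x hx y hy hxy
  simp only [Finset.mem_coe, Finset.mem_filter] at hx hy
  have h := hT y hy
  rw [← hxy] at h
  exact (hT x hx).mid_unique hx.1 h

theorem disjoint_cornerRanges (S : Set Pt) (X : Finset Pt) :
    Disjoint (cornerRanges S X 1) (cornerRanges S X (-1)) := by
  rw [Set.disjoint_left]
  rintro T ⟨x, hx, a, b, h⟩ ⟨x', hx', a', b', h'⟩
  obtain rfl := h.mid_unique hx h'
  have heq := h'.inter_eq.symm.trans h.inter_eq
  have ha : a' ∈ ({a, x, b} : Set Pt) := heq ▸ (by simp)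
  have hb : b' ∈ ({a, x, b} : Set Pt) := heq ▸ (by simp)
  have h1 := h.left
  have h2 := h.right
  have h3 := h'.left
  have h4 := h'.right
  have h5 := h.det_pos
  have h6 := h'.det_pos
  obtain rfl : a' = b := by
    rcases ha with rfl | rfl | rfl
    · linarith
    · linarith
    · rfl
  obtain rfl : b' = a := by
    rcases hb with rfl | rfl | rfl
    · rfl
    · linarith
    · linarith
  have : det a' x b' = - det b' x a' := by simp only [det]; ring
  linarith

theorem exists_sorted_triple {p q r : Pt} (hpq : p 0 ≠ q 0) (hpr : p 0 ≠ r 0) (hqr : q 0 ≠ r 0) :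
    ∃ l m u : Pt, ({p, q, r} : Set Pt) = {l, m, u} ∧ l 0 < m 0 ∧ m 0 < u 0 := by
  rcases hpq.lt_or_gt with h1 | h1 <;> rcases hpr.lt_or_gt with h2 | h2 <;>
    rcases hqr.lt_or_gt with h3 | h3
  · exact ⟨p, q, r, rfl, h1, h3⟩
  · exact ⟨p, r, q, by ext; simp; tauto, h2, h3⟩
  · linarith
  · exact ⟨r, p, q, by ext; simp; tauto, h2, h1⟩
  · exact ⟨q, p, r, by ext; simp; tauto, h1, h2⟩
  · linarith
  · exact ⟨q, r, p, by ext; simp; tauto, h3, h2⟩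
  · exact ⟨r, q, p, by ext; simp; tauto, h3, h1⟩

theorem typeIRanges_three_eq {S : Set Pt} (hS : NiceShape S) {X : Finset Pt} (hX : GenPos S X) :
    typeIRanges S X 3 = cornerRanges S X 1 ∪ cornerRanges S X (-1) := by
  have hcomp : IsCompact S := hS.2.2.1
  apply Set.Subset.antisymm
  · rintro T ⟨hT, hk, hb⟩
    have hsub := ((hT.isCompact hcomp).isClosed).frontier_subset
    have heq : (X : Set Pt) ∩ frontier T = ↑X ∩ T :=
      Set.eq_of_subset_of_ncard_le (Set.inter_subset_inter_right _ hsub) (by omega)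
        (X.finite_toSet.inter_of_left _)
    obtain ⟨p, q, r, hpq, hpr, hqr, h3⟩ := Set.ncard_eq_three.1 hb
    have hmem : ∀ z ∈ ({p, q, r} : Set Pt), z ∈ X ∧ z ∈ frontier T := fun z hz => by
      rw [← h3] at hz
      exact hz
    obtain ⟨l, m, u, he, hlm, hmu⟩ := exists_sorted_triple
      (hX.1 p (hmem p (by simp)).1 q (hmem q (by simp)).1 hpq)
      (hX.1 p (hmem p (by simp)).1 r (hmem r (by simp)).1 hpr)
      (hX.1 q (hmem q (by simp)).1 r (hmem r (by simp)).1 hqr)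
    rw [he] at hmem h3
    obtain ⟨hl, hlT⟩ := hmem l (by simp)
    obtain ⟨hm, hmT⟩ := hmem m (by simp)
    obtain ⟨hu, huT⟩ := hmem u (by simp)
    have hdet := hX.det_ne_zero hl hm hu (fun h => by rw [h] at hlm; linarith)
      (fun h => by rw [h] at hlm; linarith) (fun h => by rw [h] at hmu; linarith)
    rcases hdet.lt_or_gt with hd | hd
    · refine Or.inr ⟨m, hm, u, l, ⟨⟨hu, hl, by linarith, by linarith, ?_⟩, hT, huT, hmT, hlT, ?_⟩⟩
      · have : det u m l = - det l m u := by simp only [det]; ring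
        linarith
      · rw [← heq, h3]
        ext; simp; tauto
    · exact Or.inl ⟨m, hm, l, u, ⟨⟨hl, hu, by linarith, by linarith, hd⟩, hT, hlT, hmT, huT,
        by rw [← heq, h3]⟩⟩
  · have key : ∀ τ, cornerRanges S X τ ⊆ typeIRanges S X 3 := by
      rintro τ T ⟨x, hx, a, b, h⟩
      have hsub := ((h.isRange.isCompact hcomp).isClosed).frontier_subset
      obtain ⟨hax, hab, hxb⟩ := ne_of_det_ne h.det_pos.ne'
      have h3 : ({a, x, b} : Set Pt).ncard = 3 := Set.ncard_eq_three.2 ⟨a, x, b, hax, hab, hxb, rfl⟩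
      have hf : (X : Set Pt) ∩ frontier T = {a, x, b} := by
        apply Set.Subset.antisymm
        · rw [← h.inter_eq]
          exact Set.inter_subset_inter_right _ hsub
        · rintro y (rfl | rfl | rfl)
          · exact ⟨h.mem_left, h.left_mem⟩
          · exact ⟨hx, h.mid_mem⟩
          · exact ⟨h.mem_right, h.right_mem⟩
      exact ⟨h.isRange, by rw [h.inter_eq, h3], by rw [hf, h3]⟩
    exact Set.union_subset (key _) (key _)

theorem finite_cornerRanges {S : Set Pt} (hS : NiceShape S) {X : Finset Pt} (hX : GenPos S X)
    (τ : ℝ) : (cornerRanges S X τ).Finite := by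
  have hmaps : ∀ T ∈ cornerRanges S X τ, ∃ x ∈ X, ∃ a b, CornerRange S X τ x a b T := fun T h => h
  choose! f hf a b h using hmaps
  refine Set.Finite.of_finite_image (f := f) (X.finite_toSet.subset ?_) ?_
  · rintro _ ⟨T, hT, rfl⟩
    exact hf T hT
  · intro T hT T' hT' hTT'
    have h' := h T' hT'
    rw [← hTT'] at h'
    exact (h T hT).unique hS hX (hf T hT) h'

open Classical in
theorem ncard_typeIRanges_three {S : Set Pt} (hS : NiceShape S) {X : Finset Pt}
    (hX : GenPos S X) :
    (typeIRanges S X 3).ncard =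
      (X.filter (Covered X 1)).card + (X.filter (Covered X (-1))).card := by
  rw [typeIRanges_three_eq hS hX, Set.ncard_union_eq (disjoint_cornerRanges S X)
    (finite_cornerRanges hS hX _) (finite_cornerRanges hS hX _),
    ncard_cornerRanges hS hX one_ne_zero, ncard_cornerRanges hS hX (neg_ne_zero.2 one_ne_zero)]

theorem frontier_setOf_le {f : Pt →ₗ[ℝ] ℝ} (hf : f ≠ 0) (a : ℝ) :
    frontier {x | f x ≤ a} = {x | f x = a} := by
  have hcont : Continuous f := f.continuous_of_finiteDimensional
  have hopen : IsOpenMap f := f.isOpenMap_of_finiteDimensional (LinearMap.surjective hf)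
  have h := hopen.preimage_frontier_eq_frontier_preimage hcont (Set.Iic a)
  rw [frontier_Iic] at h
  exact h.symm

/-- The closed halfplane to the left of the directed line from `p` to `q`. -/
def side (p q : Pt) : Set Pt := {z | 0 ≤ det p q z}

theorem side_eq (p q : Pt) :
    side p q = {z | lin (q 1 - p 1) (p 0 - q 0) z ≤ lin (q 1 - p 1) (p 0 - q 0) p} := by
  ext z
  simp only [side, det, lin_apply, Set.mem_ofPred_eq]
  constructor <;> intro h <;> linarith

theorem isClosedHalfplane_side {p q : Pt} (h : p 0 ≠ q 0) : IsClosedHalfplane (side p q) :=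
  ⟨_, _, lin_ne_zero (Or.inr (sub_ne_zero.2 h)), side_eq p q⟩

theorem frontier_side {p q : Pt} (h : p 0 ≠ q 0) : frontier (side p q) = {z | det p q z = 0} := by
  rw [side_eq, frontier_setOf_le (lin_ne_zero (Or.inr (sub_ne_zero.2 h)))]
  ext z
  simp only [det, lin_apply, Set.mem_ofPred_eq]
  constructor <;> intro h <;> linarith

theorem IsClosedHalfplane.frontier_subset {H : Set Pt} (hH : IsClosedHalfplane H) :
    frontier H ⊆ H := by
  obtain ⟨f, a, hf, rfl⟩ := hH
  rw [frontier_setOf_le hf]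
  exact fun z hz => le_of_eq hz

/-- A closed halfplane is determined up to orientation by two boundary points. -/
theorem IsClosedHalfplane.eq_side {H : Set Pt} (hH : IsClosedHalfplane H) {p q : Pt}
    (h : p 0 ≠ q 0) (hp : p ∈ frontier H) (hq : q ∈ frontier H) : H = side p q ∨ H = side q p := by
  obtain ⟨f, a, hf, rfl⟩ := hH
  rw [frontier_setOf_le hf] at hp hq
  have hp : f p = a := hp
  have hq : f q = a := hq
  have hlin : ∀ z, f z = f !₂[1, 0] * z 0 + f !₂[0, 1] * z 1 := by
    intro z
    have : z = z 0 • !₂[1, 0] + z 1 • !₂[0, 1] := by apply eq_of_coords <;> simp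
    conv_lhs => rw [this]
    simp only [map_add, map_smul, smul_eq_mul]
    ring
  have hne : q 0 - p 0 ≠ 0 := sub_ne_zero.2 h.symm
  have h1 := hlin p
  have h2 := hlin q
  set α := f !₂[1, 0]
  set β := f !₂[0, 1]
  have hα : α * (q 0 - p 0) = - β * (q 1 - p 1) := by linarith
  have key : ∀ z, f z - a = β / (q 0 - p 0) * det p q z := by
    intro z
    rw [eq_comm, div_mul_eq_mul_div, div_eq_iff hne, ← hp, hlin z, h1]
    simp only [det]
    linear_combination (p 0 - z 0) * hα
  have hβ : β ≠ 0 := by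
    intro h0
    apply hf
    have hα0 : α = 0 := by
      rw [h0] at hα
      simpa [hne] using hα
    ext z
    rw [hlin z, h0, hα0]
    simp
  have hκ : β / (q 0 - p 0) ≠ 0 := div_ne_zero hβ hne
  rcases hκ.lt_or_gt with hlt | hgt
  · left
    ext z
    simp only [side, Set.mem_ofPred_eq]
    rw [← sub_nonpos, key z]
    refine ⟨fun h => ?_, mul_nonpos_of_nonpos_of_nonneg hlt.le⟩
    by_contra! h'
    exact (mul_pos_of_neg_of_neg hlt h').not_ge h
  · right
    ext z
    simp only [side, Set.mem_ofPred_eq]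
    rw [← sub_nonpos, key z, det_swap p q z, neg_nonneg]
    refine ⟨fun h => ?_, mul_nonpos_of_nonneg_of_nonpos hgt.le⟩
    by_contra! h'
    exact (mul_pos hgt h').not_ge h

/-- `H` is the halfplane bounded by a hull edge of `X` from `y` to `x` having `X` on its other
side, where `y` precedes `x` in the horizontal direction of sign `τ`. -/
structure HullEdge (X : Finset Pt) (τ : ℝ) (x y : Pt) (H : Set Pt) : Prop where
  mem : x ∈ X
  mem_left : y ∈ X
  left : τ * (y 0 - x 0) < 0
  eq_side : H = side y x
  det_neg : ∀ z ∈ X, z ≠ y → z ≠ x → det y x z < 0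

theorem HullEdge.zero_ne {X : Finset Pt} {τ : ℝ} {x y : Pt} {H : Set Pt}
    (h : HullEdge X τ x y H) : y 0 ≠ x 0 := fun e => by
  have := h.left
  rw [e] at this
  simp at this

theorem HullEdge.inter_eq {X : Finset Pt} {τ : ℝ} {x y : Pt} {H : Set Pt}
    (h : HullEdge X τ x y H) : (X : Set Pt) ∩ H = {y, x} := by
  rw [h.eq_side]
  apply Set.Subset.antisymm
  · rintro z ⟨hz, hzH⟩
    by_contra hne
    simp only [Set.mem_insert_iff, Set.mem_singleton_iff, not_or] at hne
    exact (h.det_neg z hz hne.1 hne.2).not_ge hzH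
  · rintro z (rfl | rfl)
    · exact ⟨h.mem_left, by simp [side, det_self_left]⟩
    · exact ⟨h.mem, by simp [side, det_self_right]⟩

theorem HullEdge.inter_frontier_eq {X : Finset Pt} {τ : ℝ} {x y : Pt} {H : Set Pt}
    (h : HullEdge X τ x y H) : (X : Set Pt) ∩ frontier H = {y, x} := by
  rw [h.eq_side, frontier_side h.zero_ne]
  apply Set.Subset.antisymm
  · rintro z ⟨hz, hzH⟩
    by_contra hne
    simp only [Set.mem_insert_iff, Set.mem_singleton_iff, not_or] at hne
    exact (h.det_neg z hz hne.1 hne.2).ne hzH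
  · rintro z (rfl | rfl)
    · exact ⟨h.mem_left, by simp [det_self_left]⟩
    · exact ⟨h.mem, by simp [det_self_right]⟩

theorem HullEdge.unique {X : Finset Pt} {τ : ℝ} {x y y' : Pt} {H H' : Set Pt}
    (h : HullEdge X τ x y H) (h' : HullEdge X τ x y' H') : H = H' := by
  by_cases hy : y = y'
  · rw [h.eq_side, h'.eq_side, hy]
  · have h1 := h.det_neg y' h'.mem_left (Ne.symm hy) (fun e => h'.zero_ne (by rw [e]))
    have h2 := h'.det_neg y h.mem_left hy (fun e => h.zero_ne (by rw [e]))
    have : det y' x y = - det y x y' := by simp only [det]; ring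
    linarith

theorem HullEdge.end_unique {X : Finset Pt} {τ : ℝ} {x y x' y' : Pt} {H : Set Pt}
    (h : HullEdge X τ x y H) (h' : HullEdge X τ x' y' H) : x = x' := by
  have heq := h.inter_eq.symm.trans h'.inter_eq
  have hx : x ∈ ({y', x'} : Set Pt) := heq ▸ (by simp)
  have hy : y ∈ ({y', x'} : Set Pt) := heq ▸ (by simp)
  have h1 := h.left
  have h2 := h'.left
  rcases hx with rfl | rfl
  · rcases hy with rfl | rfl
    · simp at h1
    · linarith
  · rfl

theorem HullEdge.not_covered {X : Finset Pt} {τ : ℝ} {x y : Pt} {H : Set Pt}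
    (h : HullEdge X τ x y H) : ¬ Covered X τ x := by
  rintro ⟨a, b, hc⟩
  have h1 := h.left
  have h2 := hc.left
  have h3 := hc.right
  have h4 := hc.det_pos
  obtain ⟨hax, hab, hxb⟩ := ne_of_det_ne h4.ne'
  have hby : b ≠ y := by
    rintro rfl
    linarith
  have hb := h.det_neg b hc.mem_right hby hxb.symm
  by_cases hay : a = y
  · subst hay
    linarith
  have ha := h.det_neg a hc.mem_left hay hax
  have hid : det a x b * (τ * (y 0 - x 0)) = det y x b * (τ * (a 0 - x 0)) +
      - det y x a * (τ * (b 0 - x 0)) := by simp only [det]; ring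
  have k1 := mul_pos_of_neg_of_neg hb h2
  have k2 := mul_pos (neg_pos.2 ha) h3
  have k3 := mul_neg_of_pos_of_neg h4 h1
  linarith

theorem exists_hullEdge {S : Set Pt} {X : Finset Pt} (hX : GenPos S X) {τ : ℝ} (hτ : τ ≠ 0)
    {x : Pt} (hx : x ∈ X) (hcov : ¬ Covered X τ x) (hleft : ∃ y ∈ X, τ * (y 0 - x 0) < 0) :
    ∃ H y, HullEdge X τ x y H := by
  classical
  obtain ⟨y₀, hy₀, hl₀⟩ := hleft
  obtain ⟨y, hy, hmin⟩ := (X.filter fun y => τ * (y 0 - x 0) < 0).exists_min_image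
    (fun y => (y 1 - x 1) / (y 0 - x 0)) ⟨y₀, Finset.mem_filter.2 ⟨hy₀, hl₀⟩⟩
  obtain ⟨hyX, hyl⟩ := Finset.mem_filter.1 hy
  have hne : ∀ z : Pt, τ * (z 0 - x 0) ≠ 0 → z 0 - x 0 ≠ 0 := fun z hz e => hz (by simp [e])
  have hyx : y ≠ x := fun e => by simp [e] at hyl
  refine ⟨side y x, y, ⟨hx, hyX, hyl, rfl, fun z hz hzy hzx => ?_⟩⟩
  have hd := hX.det_ne_zero hyX hx hz hyx (Ne.symm hzy) (Ne.symm hzx)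
  refine lt_of_le_of_ne ?_ hd
  have hz0 : τ * (z 0 - x 0) ≠ 0 := mul_ne_zero hτ (sub_ne_zero.2 (hX.1 z hz x hx hzx))
  rcases hz0.lt_or_gt with hlt | hgt
  · have hm := hmin z (Finset.mem_filter.2 ⟨hz, hlt⟩)
    have hy0 := hne y hyl.ne
    have hz1 := hne z hz0
    have hprod : 0 < (z 0 - x 0) * (y 0 - x 0) := by
      have h5 := mul_pos_of_neg_of_neg hlt hyl
      by_contra! h7
      have := mul_nonneg (sq_nonneg τ) (neg_nonneg.2 h7)
      nlinarith
    have hid : det y x z = (z 0 - x 0) * (y 0 - x 0) *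
        ((y 1 - x 1) / (y 0 - x 0) - (z 1 - x 1) / (z 0 - x 0)) := by
      simp only [det]
      field_simp
      ring
    rw [hid]
    exact mul_nonpos_of_nonneg_of_nonpos hprod.le (by linarith)
  · by_contra! hpos
    exact hcov ⟨y, z, hyX, hz, hyl, hgt, hpos⟩

/-- The halfplanes bounded by the hull edges of horizontal sign `τ`. -/
def hullEdges (X : Finset Pt) (τ : ℝ) : Set (Set Pt) := {H | ∃ x y, HullEdge X τ x y H}

open Classical in
theorem ncard_hullEdges {S : Set Pt} {X : Finset Pt} (hX : GenPos S X) {τ : ℝ} (hτ : τ ≠ 0)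
    (hne : X.Nonempty) :
    (hullEdges X τ).Finite ∧
      (hullEdges X τ).ncard + (X.filter (Covered X τ)).card + 1 = X.card := by
  set U := X.filter fun x => ¬ Covered X τ x ∧ ∃ y ∈ X, τ * (y 0 - x 0) < 0 with hU
  have hex : ∀ x ∈ U, ∃ H y, HullEdge X τ x y H := by
    intro x hx
    obtain ⟨hx, hcov, hl⟩ := Finset.mem_filter.1 hx
    exact exists_hullEdge hX hτ hx hcov hl
  choose! H y hH using hex
  have himage : hullEdges X τ = H '' (U : Set Pt) := by
    ext H'
    simp only [Set.mem_image, Finset.mem_coe]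
    constructor
    · rintro ⟨x, y', h⟩
      have hc : x ∈ U :=
        Finset.mem_filter.2 ⟨h.mem, h.not_covered, y', h.mem_left, h.left⟩
      exact ⟨x, hc, (hH x hc).unique h⟩
    · rintro ⟨x, hc, rfl⟩
      exact ⟨x, _, hH x hc⟩
  have hinj : Set.InjOn H (U : Set Pt) := by
    intro x hx x' hx' hxx
    have h := hH x' hx'
    rw [← hxx] at h
    exact (hH x hx).end_unique h
  refine ⟨himage ▸ U.finite_toSet.image H, ?_⟩
  rw [himage, hinj.ncard_image, Set.ncard_coe_finset]
  obtain ⟨m, hm, hmin⟩ := X.exists_min_image (fun z => τ * z 0) hne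
  have hmU : m ∉ U := by
    intro h
    obtain ⟨-, -, y, hy, hl⟩ := Finset.mem_filter.1 h
    have := hmin y hy
    linarith
  have hins : X.filter (fun x => ¬ Covered X τ x) = insert m U := by
    ext z
    simp only [Finset.mem_filter, Finset.mem_insert, hU]
    constructor
    · rintro ⟨hz, hc⟩
      by_cases hzm : z = m
      · exact Or.inl hzm
      · refine Or.inr ⟨hz, hc, m, hm, ?_⟩
        have h1 := hmin z hz
        have h2 : τ * (m 0 - z 0) ≠ 0 :=
          mul_ne_zero hτ (sub_ne_zero.2 (hX.1 m hm z hz (Ne.symm hzm)))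
        exact lt_of_le_of_ne (by linarith) h2
    · rintro (rfl | h)
      · refine ⟨hm, ?_⟩
        rintro ⟨a, b, hc⟩
        have h1 := hmin a hc.mem_left
        have h2 := hc.left
        linarith
      · exact ⟨h.1, h.2.1⟩
  have hcard := Finset.card_filter_add_card_filter_not (s := X) (Covered X τ)
  rw [hins, Finset.card_insert_of_notMem hmU] at hcard
  omega

theorem disjoint_hullEdges {X : Finset Pt} (h3 : 3 ≤ X.card) :
    Disjoint (hullEdges X 1) (hullEdges X (-1)) := by
  classical
  rw [Set.disjoint_left]
  rintro H ⟨x, y, h⟩ ⟨x', y', h'⟩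
  have heq := h'.inter_eq.symm.trans h.inter_eq
  have hx : x' ∈ ({y, x} : Set Pt) := heq ▸ (by simp)
  have hy : y' ∈ ({y, x} : Set Pt) := heq ▸ (by simp)
  have h1 := h.left
  have h2 := h'.left
  obtain ⟨z, hz, hzn⟩ : ∃ z ∈ X, z ∉ ({y, x} : Finset Pt) := by
    by_contra! hsub
    have := Finset.card_le_card (show X ⊆ {y, x} from hsub)
    have := Finset.card_le_two (a := y) (b := x)
    omega
  simp only [Finset.mem_insert, Finset.mem_singleton, not_or] at hzn
  have hneg := h.det_neg z hz hzn.1 hzn.2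
  rcases hx with rfl | rfl
  · rcases hy with rfl | rfl
    · simp at h2
    · have := h'.det_neg z hz hzn.2 hzn.1
      rw [det_swap] at this
      linarith
  · rcases hy with rfl | rfl
    · linarith
    · simp at h2

theorem repHalfplanes_two_eq {S : Set Pt} {X : Finset Pt} (hX : GenPos S X) :
    repHalfplanes X 2 = hullEdges X 1 ∪ hullEdges X (-1) := by
  apply Set.Subset.antisymm
  · rintro H ⟨hH, hk, hb⟩
    have heq : (X : Set Pt) ∩ frontier H = ↑X ∩ H :=
      Set.eq_of_subset_of_ncard_le (Set.inter_subset_inter_right _ hH.frontier_subset) (by omega)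
        (X.finite_toSet.inter_of_left _)
    obtain ⟨p, q, hpq, h2⟩ := Set.ncard_eq_two.1 hb
    have hp : p ∈ (X : Set Pt) ∩ frontier H := h2 ▸ (by simp)
    have hq : q ∈ (X : Set Pt) ∩ frontier H := h2 ▸ (by simp)
    have hpq0 := hX.1 p hp.1 q hq.1 hpq
    have key : ∀ x y, x ∈ X → y ∈ X → y 0 ≠ x 0 → (X : Set Pt) ∩ H = {y, x} → H = side y x →
        H ∈ hullEdges X 1 ∪ hullEdges X (-1) := by
      intro x y hx hy hyx h2 hs
      have hneg : ∀ z ∈ X, z ≠ y → z ≠ x → det y x z < 0 := by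
        intro z hz hzy hzx
        by_contra! hd
        have : z ∈ (X : Set Pt) ∩ H := ⟨hz, hs ▸ hd⟩
        rw [h2] at this
        exact this.elim hzy hzx
      rcases hyx.lt_or_gt with h | h
      · exact Or.inl ⟨x, y, hx, hy, by linarith, hs, hneg⟩
      · exact Or.inr ⟨x, y, hx, hy, by linarith, hs, hneg⟩
    rw [heq] at h2
    rcases hH.eq_side hpq0 hp.2 hq.2 with h | h
    · exact key q p hq.1 hp.1 hpq0 h2 h
    · exact key p q hp.1 hq.1 hpq0.symm (by rw [h2, Set.pair_comm]) h
  · have key : ∀ τ, hullEdges X τ ⊆ repHalfplanes X 2 := by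
      rintro τ H ⟨x, y, h⟩
      have hyx : y ≠ x := fun e => h.zero_ne (by rw [e])
      exact ⟨h.eq_side ▸ isClosedHalfplane_side h.zero_ne, by rw [h.inter_eq, Set.ncard_pair hyx],
        by rw [h.inter_frontier_eq, Set.ncard_pair hyx]⟩
    exact Set.union_subset (key _) (key _)

theorem ncard_typeIRanges_three_add {S : Set Pt} (hS : NiceShape S) {X : Finset Pt}
    (hX : GenPos S X) (h3 : 3 ≤ X.card) :
    (typeIRanges S X 3).ncard + (repHalfplanes X 2).ncard + 2 = 2 * X.card := by
  classical
  have hne : X.Nonempty := Finset.card_pos.1 (by omega)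
  obtain ⟨f₁, c₁⟩ := ncard_hullEdges hX one_ne_zero hne
  obtain ⟨f₂, c₂⟩ := ncard_hullEdges hX (neg_ne_zero.2 one_ne_zero) hne
  rw [ncard_typeIRanges_three hS hX, repHalfplanes_two_eq hX,
    Set.ncard_union_eq (disjoint_hullEdges h3) f₁ f₂]
  omega

/-- The members of a family containing `k` points of `X`, exactly `b` of them on the boundary. -/
def levelFamily (𝒯 : Set (Set Pt)) (b : ℕ) (X : Finset Pt) (k : ℕ) : Set (Set Pt) :=
  {T | T ∈ 𝒯 ∧ ((X : Set Pt) ∩ T).ncard = k ∧ ((X : Set Pt) ∩ frontier T).ncard = b}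

open Classical in
theorem ncard_coe_inter (X : Finset Pt) (T : Set Pt) :
    ((X : Set Pt) ∩ T).ncard = (X.filter (· ∈ T)).card := by
  rw [← Set.ncard_coe_finset]
  congr 1
  ext z
  simp

theorem card_filter_erase {α : Type*} [DecidableEq α] {X A B : Finset α} (hBA : B ⊆ A)
    (hAX : A ⊆ X) {k : ℕ} (hk : 1 ≤ k) :
    ((X.filter fun x => x ∉ B ∧ (A.erase x).card = k).card : ℤ) =
      (if A.card = k then (X.card : ℤ) - k else 0) +
        (if A.card = k + 1 then (k : ℤ) + 1 - B.card else 0) := by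
  by_cases h₁ : A.card = k
  · have : (X.filter fun x => x ∉ B ∧ (A.erase x).card = k) = X \ A := by
      ext x
      simp only [Finset.mem_filter, Finset.mem_sdiff]
      refine and_congr_right fun hx => ⟨fun h hxA => ?_, fun h => ?_⟩
      · have := Finset.card_erase_of_mem hxA
        omega
      · exact ⟨fun hxB => h (hBA hxB), by rw [Finset.erase_eq_of_notMem h, h₁]⟩
    rw [this, Finset.cast_card_sdiff hAX, if_pos h₁, if_neg (by omega), h₁]
    ring
  by_cases h₂ : A.card = k + 1
  · have : (X.filter fun x => x ∉ B ∧ (A.erase x).card = k) = A \ B := by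
      ext x
      simp only [Finset.mem_filter, Finset.mem_sdiff]
      constructor
      · rintro ⟨hx, hxB, hc⟩
        refine ⟨?_, hxB⟩
        by_contra hxA
        rw [Finset.erase_eq_of_notMem hxA] at hc
        exact h₁ hc
      · rintro ⟨hxA, hxB⟩
        refine ⟨hAX hxA, hxB, ?_⟩
        rw [Finset.card_erase_of_mem hxA, h₂]
        rfl
    rw [this, Finset.cast_card_sdiff hBA, if_neg h₁, if_pos h₂, h₂]
    push_cast
    ring
  · rw [if_neg h₁, if_neg h₂, Finset.filter_false_of_mem]
    · simp
    · rintro x hx ⟨-, hc⟩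
      by_cases hxA : x ∈ A
      · have := Finset.card_erase_add_one hxA
        omega
      · rw [Finset.erase_eq_of_notMem hxA] at hc
        exact h₁ hc

/-- Double counting of a level family under deletion of one point. -/
theorem sum_ncard_levelFamily_erase {𝒯 : Set (Set Pt)} {b : ℕ} {X : Finset Pt} [DecidableEq Pt]
    (hsub : ∀ T ∈ 𝒯, frontier T ⊆ T)
    (hle : ∀ T ∈ 𝒯, ((X : Set Pt) ∩ frontier T).ncard ≤ b)
    (hfin : {T | T ∈ 𝒯 ∧ ((X : Set Pt) ∩ frontier T).ncard = b}.Finite) {k : ℕ} (hk : 1 ≤ k) :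
    ∑ x ∈ X, ((levelFamily 𝒯 b (X.erase x) k).ncard : ℤ) =
      ((X.card : ℤ) - k) * (levelFamily 𝒯 b X k).ncard +
        ((k : ℤ) + 1 - b) * (levelFamily 𝒯 b X (k + 1)).ncard := by
  classical
  set F := hfin.toFinset with hF
  have hFmem : ∀ T, T ∈ F ↔ T ∈ 𝒯 ∧ (X.filter (· ∈ frontier T)).card = b := by
    intro T
    rw [hF, Set.Finite.mem_toFinset, ← ncard_coe_inter]
    rfl
  have hlevel : ∀ m, (levelFamily 𝒯 b X m).ncard =
      (F.filter fun T => (X.filter (· ∈ T)).card = m).card := by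
    intro m
    rw [← Set.ncard_coe_finset]
    congr 1
    ext T
    simp only [levelFamily, ncard_coe_inter, Set.mem_ofPred_eq, Finset.coe_filter, hFmem]
    tauto
  have hsplit : ∀ x ∈ X, (levelFamily 𝒯 b (X.erase x) k).ncard =
      (F.filter fun T => x ∉ X.filter (· ∈ frontier T) ∧
        ((X.filter (· ∈ T)).erase x).card = k).card := by
    intro x hx
    rw [← Set.ncard_coe_finset]
    congr 1
    ext T
    simp only [levelFamily, ncard_coe_inter, Set.mem_ofPred_eq, Finset.coe_filter, hFmem,
      Finset.filter_erase]
    constructor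
    · rintro ⟨hT, h₁, h₂⟩
      have h₃ := hle T hT
      rw [ncard_coe_inter] at h₃
      have hxB : x ∉ X.filter (· ∈ frontier T) := by
        intro hxB
        have := Finset.card_erase_add_one hxB
        omega
      rw [Finset.erase_eq_of_notMem hxB] at h₂
      exact ⟨⟨hT, h₂⟩, hxB, h₁⟩
    · rintro ⟨⟨hT, h₂⟩, hxB, h₁⟩
      exact ⟨hT, h₁, by rw [Finset.erase_eq_of_notMem hxB, h₂]⟩
  have hswap : ∑ x ∈ X, (levelFamily 𝒯 b (X.erase x) k).ncard =
      ∑ T ∈ F, (X.filter fun x => x ∉ X.filter (· ∈ frontier T) ∧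
        ((X.filter (· ∈ T)).erase x).card = k).card := by
    rw [Finset.sum_congr rfl hsplit]
    exact Finset.sum_card_bipartiteAbove_eq_sum_card_bipartiteBelow
      (fun x T => x ∉ X.filter (· ∈ frontier T) ∧ ((X.filter (· ∈ T)).erase x).card = k)
  have hcast := congrArg (Nat.cast : ℕ → ℤ) hswap
  push_cast at hcast
  rw [hcast, hlevel, hlevel, Finset.card_filter, Finset.card_filter]
  push_cast
  rw [Finset.mul_sum, Finset.mul_sum, ← Finset.sum_add_distrib]
  refine Finset.sum_congr rfl fun T hT => ?_
  obtain ⟨hT𝒯, hTb⟩ := (hFmem T).1 hT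
  have hBA : X.filter (· ∈ frontier T) ⊆ X.filter (· ∈ T) :=
    Finset.monotone_filter_right X fun z _ hz => hsub T hT𝒯 hz
  rw [card_filter_erase hBA (Finset.filter_subset _ _) hk, hTb]
  simp only [mul_ite, mul_one, mul_zero]

theorem GenPos.ncard_inter_frontier_le {S T : Set Pt} {X : Finset Pt} (hX : GenPos S X)
    (hT : IsRange S T) : ((X : Set Pt) ∩ frontier T).ncard ≤ 3 := by
  by_contra! h
  obtain ⟨Y, hY, hYc⟩ := Set.exists_subset_card_eq (Nat.succ_le_of_lt h)
  obtain ⟨p, q, r, s, hpq, hpr, hps, hqr, hqs, hrs, rfl⟩ := Set.ncard_eq_four.1 hYc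
  exact hX.2.2 T hT p q r s (hY (by simp)) (hY (by simp)) (hY (by simp)) (hY (by simp))
    hpq hpr hps hqr hqs hrs

theorem finite_isRange_three {S : Set Pt} (hS : NiceShape S) {X : Finset Pt} (hX : GenPos S X) :
    {T | IsRange S T ∧ ((X : Set Pt) ∩ frontier T).ncard = 3}.Finite := by
  refine Set.Finite.of_finite_image (f := fun T => (X : Set Pt) ∩ frontier T)
    (X.finite_toSet.finite_subsets.subset ?_) ?_
  · rintro _ ⟨T, -, rfl⟩
    exact Set.inter_subset_left
  · rintro T ⟨hT, h3⟩ T' ⟨hT', -⟩ heq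
    have hsub := ((hT.isCompact hS.2.2.1).isClosed).frontier_subset
    have hsub' := ((hT'.isCompact hS.2.2.1).isClosed).frontier_subset
    simp only at heq
    obtain ⟨p, q, r, hpq, hpr, hqr, he⟩ := Set.ncard_eq_three.1 h3
    have hmem : ∀ z ∈ ({p, q, r} : Set Pt), z ∈ X ∧ z ∈ frontier T ∧ z ∈ frontier T' := by
      intro z hz
      rw [← he] at hz
      exact ⟨hz.1, hz.2, (heq ▸ hz : z ∈ (X : Set Pt) ∩ frontier T').2⟩
    obtain ⟨hp, hpT, hpT'⟩ := hmem p (by simp)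
    obtain ⟨hq, hqT, hqT'⟩ := hmem q (by simp)
    obtain ⟨hr, hrT, hrT'⟩ := hmem r (by simp)
    rcases (hX.det_ne_zero hp hq hr hpq hpr hqr).lt_or_gt with hd | hd
    · have hd' : 0 < det q p r := by rw [det_swap]; linarith
      exact isRange_eq_of_three hS.strictConvex hS.2.2.1 hT hT' hqT hpT hqT' hpT' (hsub hrT)
        hrT'.2 (hsub' hrT') hrT.2 hd' hd'
    · exact isRange_eq_of_three hS.strictConvex hS.2.2.1 hT hT' hpT hqT hpT' hqT' (hsub hrT)
        hrT'.2 (hsub' hrT') hrT.2 hd hd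

theorem GenPos.ncard_inter_frontier_halfplane_le {S H : Set Pt} {X : Finset Pt}
    (hX : GenPos S X) (hH : IsClosedHalfplane H) : ((X : Set Pt) ∩ frontier H).ncard ≤ 2 := by
  by_contra! h
  obtain ⟨Y, hY, hYc⟩ := Set.exists_subset_card_eq (Nat.succ_le_of_lt h)
  obtain ⟨p, q, r, hpq, hpr, hqr, rfl⟩ := Set.ncard_eq_three.1 hYc
  have hp := hY (show p ∈ ({p, q, r} : Set Pt) by simp)
  have hq := hY (show q ∈ ({p, q, r} : Set Pt) by simp)
  have hr := hY (show r ∈ ({p, q, r} : Set Pt) by simp)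
  have h0 := hX.1 p hp.1 q hq.1 hpq
  have hdet := hX.det_ne_zero hp.1 hq.1 hr.1 hpq hpr hqr
  have hrf := hr.2
  rcases hH.eq_side h0 hp.2 hq.2 with rfl | rfl
  · rw [frontier_side h0] at hrf
    exact hdet hrf
  · rw [frontier_side h0.symm] at hrf
    have hrf : det q p r = 0 := hrf
    rw [det_swap] at hrf
    exact hdet (neg_eq_zero.1 hrf)

theorem finite_isClosedHalfplane_two {S : Set Pt} {X : Finset Pt} (hX : GenPos S X) :
    {H | IsClosedHalfplane H ∧ ((X : Set Pt) ∩ frontier H).ncard = 2}.Finite := by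
  refine ((X.finite_toSet.prod X.finite_toSet).image fun pq => side pq.1 pq.2).subset ?_
  rintro H ⟨hH, h2⟩
  obtain ⟨p, q, hpq, he⟩ := Set.ncard_eq_two.1 h2
  have hp : p ∈ (X : Set Pt) ∩ frontier H := he ▸ (by simp)
  have hq : q ∈ (X : Set Pt) ∩ frontier H := he ▸ (by simp)
  rcases hH.eq_side (hX.1 p hp.1 q hq.1 hpq) hp.2 hq.2 with rfl | rfl
  · exact ⟨(p, q), ⟨hp.1, hq.1⟩, rfl⟩
  · exact ⟨(q, p), ⟨hq.1, hp.1⟩, rfl⟩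

theorem sum_ncard_typeIRanges_erase {S : Set Pt} (hS : NiceShape S) {X : Finset Pt}
    [DecidableEq Pt] (hX : GenPos S X) {k : ℕ} (hk : 1 ≤ k) :
    ∑ x ∈ X, ((typeIRanges S (X.erase x) k).ncard : ℤ) =
      ((X.card : ℤ) - k) * (typeIRanges S X k).ncard +
        ((k : ℤ) - 2) * (typeIRanges S X (k + 1)).ncard := by
  have h := sum_ncard_levelFamily_erase (𝒯 := {T | IsRange S T}) (b := 3) (X := X)
    (fun T hT => ((IsRange.isCompact hT hS.2.2.1).isClosed).frontier_subset)
    (fun T hT => hX.ncard_inter_frontier_le hT) (finite_isRange_three hS hX) hk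
  refine h.trans ?_
  have e : (k : ℤ) + 1 - (3 : ℕ) = k - 2 := by push_cast; ring
  rw [e]
  rfl

theorem sum_ncard_repHalfplanes_erase {S : Set Pt} {X : Finset Pt} [DecidableEq Pt]
    (hX : GenPos S X) {i : ℕ} (hi : 1 ≤ i) :
    ∑ x ∈ X, ((repHalfplanes (X.erase x) i).ncard : ℤ) =
      ((X.card : ℤ) - i) * (repHalfplanes X i).ncard +
        ((i : ℤ) - 1) * (repHalfplanes X (i + 1)).ncard := by
  have h := sum_ncard_levelFamily_erase (𝒯 := {H | IsClosedHalfplane H}) (b := 2) (X := X)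
    (fun H hH => IsClosedHalfplane.frontier_subset hH)
    (fun H hH => hX.ncard_inter_frontier_halfplane_le hH) (finite_isClosedHalfplane_two hX) hi
  refine h.trans ?_
  have e : (i : ℤ) + 1 - (2 : ℕ) = i - 1 := by push_cast; ring
  rw [e]
  rfl

/-- Deletion turns the total number of small halfplanes into a telescoping sum. -/
theorem sum_sum_ncard_repHalfplanes_erase {S : Set Pt} {X : Finset Pt} [DecidableEq Pt]
    (hX : GenPos S X) (j : ℕ) :
    ∑ x ∈ X, ∑ i ∈ Finset.Icc 2 (j + 1), ((repHalfplanes (X.erase x) i).ncard : ℤ) =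
      ((X.card : ℤ) - 2) * ∑ i ∈ Finset.Icc 2 (j + 1), ((repHalfplanes X i).ncard : ℤ) +
        (j : ℤ) * (repHalfplanes X (j + 2)).ncard := by
  induction j with
  | zero => simp
  | succ j ih =>
    simp only [Finset.sum_Icc_succ_top (show 2 ≤ j + 1 + 1 by omega), Finset.sum_add_distrib, ih,
      sum_ncard_repHalfplanes_erase hX (show 1 ≤ j + 1 + 1 by omega)]
    push_cast
    ring

theorem ncard_typeIRanges_add_three {S : Set Pt} (hS : NiceShape S) (j : ℕ) :
    ∀ X : Finset Pt, GenPos S X → j + 3 ≤ X.card →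
      ((typeIRanges S X (j + 3)).ncard : ℤ) = 2 * ((j : ℤ) + 1) * X.card -
        ∑ i ∈ Finset.Icc 2 (j + 2), ((repHalfplanes X i).ncard : ℤ) -
        ((j : ℤ) + 2) * ((j : ℤ) + 1) := by
  classical
  induction j with
  | zero =>
    intro X hX hcard
    have h := ncard_typeIRanges_three_add hS hX (by omega)
    have h' := congrArg (Nat.cast : ℕ → ℤ) h
    push_cast at h'
    simp only [zero_add, Finset.Icc_self, Finset.sum_singleton, Nat.cast_zero]
    linarith
  | succ j ih =>
    intro X hX hcard
    have hdel := sum_ncard_typeIRanges_erase hS hX (k := j + 3) (by omega)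
    have hhalf := sum_sum_ncard_repHalfplanes_erase hX (j + 1)
    have hstep : ∀ x ∈ X, ((typeIRanges S (X.erase x) (j + 3)).ncard : ℤ) =
        2 * ((j : ℤ) + 1) * (X.card - 1) -
        ∑ i ∈ Finset.Icc 2 (j + 2), ((repHalfplanes (X.erase x) i).ncard : ℤ) -
        ((j : ℤ) + 2) * ((j : ℤ) + 1) := by
      intro x hx
      have hc := Finset.card_erase_add_one hx
      rw [ih _ (hX.mono (Finset.erase_subset x X)) (by omega), ← hc]
      push_cast
      ring
    rw [Finset.sum_congr rfl hstep, Finset.sum_sub_distrib, Finset.sum_sub_distrib,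
      Finset.sum_const, Finset.sum_const, hhalf, ih X hX (by omega)] at hdel
    rw [Finset.sum_Icc_succ_top (by omega)]
    have hpos : (j : ℤ) + 1 ≠ 0 := by positivity
    apply mul_left_cancel₀ hpos
    simp only [nsmul_eq_mul] at hdel
    push_cast at hdel ⊢
    linear_combination -hdel

/-- the number of Type I ranges satisfies
`|ℛ₁ᵏ| = 2(k−2)·|X| − ∑_{i=2}^{k−1} |𝒜ᵢ| − (k−1)(k−2)`. -/
theorem typeI_ranges_count
    (S : Set Pt) (hS : NiceShape S) (X : Finset Pt) (hX : GenPos S X)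
    (k : ℕ) (hk : 3 ≤ k) (hkX : k ≤ X.card) :
    ((typeIRanges S X k).ncard : ℤ) =
      2 * ((k : ℤ) - 2) * X.card -
        ∑ i ∈ Finset.Icc 2 (k - 1), ((repHalfplanes X i).ncard : ℤ) -
        ((k : ℤ) - 1) * ((k : ℤ) - 2) := by

  obtain ⟨j, rfl⟩ := Nat.exists_eq_add_of_le' hk
  rw [ncard_typeIRanges_add_three hS j X hX hkX, show j + 3 - 1 = j + 2 by omega]
  push_cast
  ring
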